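/- arXiv:2602.22281 — 2 statements merged into one kernel-verified Lean document; each statement's English description precedes it below -/
import Mathlib

section
/- For every k ≥ 4 there exist a finite set X, a set 𝒯 of t = k+2 unrooted binary phylogenetic trees on X, and a common m-chain C' = (x_1,…,x_m) of 𝒯 with m = 2k+1, such that every unrooted agreement forest for 𝒯 has size at least k+1, while the set of trees { T|(X ∖ {x_k,…,x_m}) : T ∈ 𝒯 } obtained by truncating C' to length k−1 has an unrooted agreement forest of size at most k. (Hence truncating common chains to length k−1 instead of min{max{k,3}, t+1} = k is not safe for parameter k.) -/
/-- An unrooted binary phylogenetic tree on taxon set `X`: a finite tree in which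
every internal vertex has degree 3 and the leaves (degree-1 vertices) are
bijectively labelled by `X`. -/
structure UTree (X : Type) : Type 1 where
  V : Type
  finV : Finite V
  g : SimpleGraph V
  isTree : g.IsTree
  label : X → V
  label_inj : Function.Injective label
  leaf_iff : ∀ v : V, (g.neighborSet v).ncard = 1 ↔ v ∈ Set.range label
  internal_deg : ∀ v : V, v ∉ Set.range label → (g.neighborSet v).ncard = 3

namespace UTree

variable {X : Type}

/-- Vertex set of the minimal subtree `T[B]` of `T` spanning the leaves labelled by `B`:
the vertices lying on a path between two leaves labelled by elements of `B`. -/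
def spanSet (T : UTree X) (B : Set X) : Set T.V :=
  {v | ∃ x ∈ B, ∃ y ∈ B, ∃ p : T.g.Walk (T.label x) (T.label y), p.IsPath ∧ v ∈ p.support}

/-- `deg^T(B)`: the number of edges of `T` with exactly one endpoint in `T[B]`. -/
noncomputable def blockDeg (T : UTree X) (B : Set X) : ℕ :=
  {e : Sym2 T.V | ∃ u v : T.V, T.g.Adj u v ∧ e = s(u, v) ∧
    u ∈ T.spanSet B ∧ v ∉ T.spanSet B}.ncard

/-- The vertices of `T[B]` surviving the suppression of degree-2 vertices:
the leaves labelled by `B` together with the branch points of `T[B]`. -/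
def keepSet (T : UTree X) (B : Set X) : Set T.V :=
  {v | v ∈ T.spanSet B ∧
    (v ∈ T.label '' B ∨ 3 ≤ (T.g.neighborSet v ∩ T.spanSet B).ncard)}

/-- Adjacency in the suppressed tree `T|B`: two surviving vertices joined by a path of
`T[B]` containing no other surviving vertex internally. -/
def restAdj (T : UTree X) (B : Set X) (u v : T.V) : Prop :=
  u ∈ T.keepSet B ∧ v ∈ T.keepSet B ∧ u ≠ v ∧
    ∃ p : T.g.Walk u v, p.IsPath ∧ (∀ w ∈ p.support, w ∈ T.spanSet B) ∧
      ∀ w ∈ p.support, w ∈ T.keepSet B → w = u ∨ w = v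

/-- `T|B = T'|B`: a leaf-label-preserving isomorphism between the suppressed trees. -/
def restEq (T T' : UTree X) (B : Set X) : Prop :=
  ∃ φ : T.V → T'.V, Set.BijOn φ (T.keepSet B) (T'.keepSet B) ∧
    (∀ x ∈ B, φ (T.label x) = T'.label x) ∧
    ∀ u v : T.V, u ∈ T.keepSet B → v ∈ T.keepSet B →
      (T.restAdj B u v ↔ T'.restAdj B (φ u) (φ v))

/-- `F` is a partition of `X` into nonempty blocks. -/
def IsForestPartition (F : Set (Set X)) : Prop :=
  (∀ B ∈ F, B.Nonempty) ∧ ∀ x : X, ∃! B, B ∈ F ∧ x ∈ B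

/-- An unrooted agreement forest for `𝒯`: a partition of `X` whose blocks have a common
topology in all trees and induce pairwise vertex-disjoint subtrees in each tree. -/
def IsAgreementForest (𝒯 : Set (UTree X)) (F : Set (Set X)) : Prop :=
  IsForestPartition F ∧
  (∀ B ∈ F, ∀ T ∈ 𝒯, ∀ T' ∈ 𝒯, restEq T T' B) ∧
  ∀ B ∈ F, ∀ B' ∈ F, B ≠ B' → ∀ T ∈ 𝒯, Disjoint (T.spanSet B) (T.spanSet B')

/-- `(x 0, …, x (m-1))` is a chain in `T`: the parent of each `x i` is equal to or
adjacent to the parent of `x (i+1)` (parents being the unique neighbours of the leaves). -/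
def IsChainIn (T : UTree X) {m : ℕ} (x : Fin m → X) : Prop :=
  ∀ (i : ℕ) (h1 : i + 1 < m), ∀ p q : T.V,
    T.g.Adj (T.label (x ⟨i, Nat.lt_of_succ_lt h1⟩)) p →
    T.g.Adj (T.label (x ⟨i + 1, h1⟩)) q → p = q ∨ T.g.Adj p q

/-- A common `m`-chain of `𝒯`: a sequence of `m ≥ 2` distinct taxa that is a chain in
every tree of `𝒯`. -/
def IsCommonChain (𝒯 : Set (UTree X)) {m : ℕ} (x : Fin m → X) : Prop :=
  2 ≤ m ∧ Function.Injective x ∧ ∀ T ∈ 𝒯, T.IsChainIn x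

/-- `T[S]` is pendant in `T`: deleting some edge splits `T` into two subtrees, one of
which contains exactly the leaves labelled by `S`. -/
def IsPendant (T : UTree X) (S : Set X) : Prop :=
  ∃ u v : T.V, T.g.Adj u v ∧
    ∀ x : X, (T.g.deleteEdges {s(u, v)}).Reachable u (T.label x) ↔ x ∈ S

/-- `u` is an attachment point of `T[S]`: a vertex of `T[S]` adjacent to a vertex
outside `T[S]`. -/
def attachPoint (T : UTree X) (S : Set X) (u : T.V) : Prop :=
  u ∈ T.spanSet S ∧ ∃ w : T.V, w ∉ T.spanSet S ∧ T.g.Adj u w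

/-- A label-preserving isomorphism between `T[S]` and `T'[S]` respecting the
attachment points. -/
def pendantIso (T T' : UTree X) (S : Set X) : Prop :=
  ∃ φ : T.V → T'.V, Set.BijOn φ (T.spanSet S) (T'.spanSet S) ∧
    (∀ x ∈ S, φ (T.label x) = T'.label x) ∧
    (∀ u v : T.V, u ∈ T.spanSet S → v ∈ T.spanSet S →
      (T.g.Adj u v ↔ T'.g.Adj (φ u) (φ v))) ∧
    ∀ u : T.V, attachPoint T S u → attachPoint T' S (φ u)

/-- `S` induces a common pendant subtree of `𝒯`. -/
def InducesCommonPendant (𝒯 : Set (UTree X)) (S : Set X) : Prop :=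
  S.Nonempty ∧ (∀ T ∈ 𝒯, IsPendant T S) ∧ ∀ T ∈ 𝒯, ∀ T' ∈ 𝒯, pendantIso T T' S

/-- `T'` is (isomorphic to) the restriction `T|X'` of `T` to the taxa in `X'`. -/
def IsRestrictionOf (T : UTree X) (X' : Set X) (T' : UTree X') : Prop :=
  ∃ φ : T'.V → T.V, Function.Injective φ ∧
    (∀ x : X', φ (T'.label x) = T.label x.val) ∧
    Set.range φ = T.keepSet X' ∧
    ∀ u v : T'.V, T'.g.Adj u v ↔ T.restAdj X' (φ u) (φ v)

/-- `𝒯' = { T|X' : T ∈ 𝒯 }` up to label-preserving isomorphism. -/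
def IsRestrictionFamily (𝒯 : Set (UTree X)) (X' : Set X) (𝒯' : Set (UTree X')) : Prop :=
  (∀ T' ∈ 𝒯', ∃ T ∈ 𝒯, IsRestrictionOf T X' T') ∧
  ∀ T ∈ 𝒯, ∃ T' ∈ 𝒯', IsRestrictionOf T X' T'

/-- The subtree reduction rule is applicable: some `S` with `|S| ≥ 2` induces a common
pendant subtree. -/
def SubtreeRuleApplicable (𝒯 : Set (UTree X)) : Prop :=
  ∃ S : Set X, 2 ≤ S.ncard ∧ InducesCommonPendant 𝒯 S

/-- The chain reduction rule (with truncation length `r`) is applicable: `𝒯` has a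
common `m`-chain with `m > r`. -/
def ChainRuleApplicable (𝒯 : Set (UTree X)) (r : ℕ) : Prop :=
  ∃ (m : ℕ) (x : Fin m → X), r < m ∧ IsCommonChain 𝒯 x

end UTree

/-! ### The comb graph -/

/-- Vertices of the comb (caterpillar) with `N` leaves. -/
@[ext] structure CV (N : ℕ) : Type where
  ix : ℕ
  fl : Bool
  lt : ix < N
  ok : fl = true → 0 < ix ∧ ix + 1 < N

namespace CV

/-- spine vertex -/
def sp {N : ℕ} (i : ℕ) (h : i < N) : CV N := ⟨i, false, h, by simp⟩

/-- leaf vertex at position `i` -/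
def lb {N : ℕ} (i : ℕ) (h : i < N) : CV N :=
  ⟨i, decide (0 < i ∧ i + 1 < N), h, by simp⟩

@[simp] lemma sp_ix {N i : ℕ} (h : i < N) : (sp i h).ix = i := rfl
@[simp] lemma sp_fl {N i : ℕ} (h : i < N) : (sp i h).fl = false := rfl
@[simp] lemma lb_ix {N i : ℕ} (h : i < N) : (lb i h).ix = i := rfl
@[simp] lemma lb_fl {N i : ℕ} (h : i < N) : (lb i h).fl = decide (0 < i ∧ i + 1 < N) := rfl

lemma eq_iff {N : ℕ} (u v : CV N) : u = v ↔ u.ix = v.ix ∧ u.fl = v.fl := by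
  constructor
  · rintro rfl; simp
  · rintro ⟨h1, h2⟩; exact CV.ext h1 h2

instance (N : ℕ) : Finite (CV N) :=
  Finite.of_injective (fun v : CV N => ((⟨v.ix, v.lt⟩ : Fin N), v.fl)) (by
    intro u v h
    simp only [Prod.mk.injEq, Fin.mk.injEq] at h
    exact CV.ext h.1 h.2)

lemma cases {N : ℕ} (v : CV N) : v = sp v.ix v.lt ∨ v = lb v.ix v.lt := by
  have := v.ok
  simp only [eq_iff, sp_ix, sp_fl, lb_ix, lb_fl]
  cases h : v.fl <;> simp_all

/-- The comb graph. -/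
def G (N : ℕ) : SimpleGraph (CV N) where
  Adj u v := (u.fl = false ∧ v.fl = false ∧ (u.ix + 1 = v.ix ∨ v.ix + 1 = u.ix)) ∨
    (u.ix = v.ix ∧ u.fl ≠ v.fl)
  symm := ⟨by rintro u v h; grind⟩
  loopless := ⟨by rintro u h; grind⟩

lemma adj_iff {N : ℕ} (u v : CV N) : (G N).Adj u v ↔
  (u.fl = false ∧ v.fl = false ∧ (u.ix + 1 = v.ix ∨ v.ix + 1 = u.ix)) ∨
    (u.ix = v.ix ∧ u.fl ≠ v.fl) := Iff.rfl

/-- vertices allowed on the canonical walk from `u` to `v` -/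
def Btw {N : ℕ} (u v w : CV N) : Prop :=
  w = u ∨ w = v ∨ (w.fl = false ∧ u.ix ≤ w.ix ∧ w.ix ≤ v.ix)

lemma walk_sp {N : ℕ} (i j : ℕ) (hij : i ≤ j) (hj : j < N) :
    ∃ p : (G N).Walk (sp i (lt_of_le_of_lt hij hj)) (sp j hj), ∀ w ∈ p.support,
      w.fl = false ∧ i ≤ w.ix ∧ w.ix ≤ j := by
  induction j, hij using Nat.le_induction with
  | base => exact ⟨.nil, by simp⟩
  | succ j hij ih =>
    obtain ⟨p, hp⟩ := ih (by omega)
    have ha : (G N).Adj (sp j (by omega)) (sp (j+1) hj) := by simp [adj_iff]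
    refine ⟨p.append (.cons ha .nil), ?_⟩
    intro w hw
    rw [SimpleGraph.Walk.mem_support_append_iff] at hw
    rcases hw with hw | hw
    · have := hp w hw; grind
    · simp at hw
      rcases hw with rfl | rfl <;> simp <;> omega

lemma walk_to_sp {N : ℕ} (v : CV N) : ∃ p : (G N).Walk v (sp v.ix v.lt), ∀ w ∈ p.support,
    w = v ∨ w = sp v.ix v.lt := by
  by_cases h : v = sp v.ix v.lt
  · have : ∀ u, u = v → ∃ p : (G N).Walk v u, ∀ w ∈ p.support, w = v ∨ w = u := by
      rintro u rfl; exact ⟨.nil, by simp⟩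
    exact this _ h.symm
  · have ha : (G N).Adj v (sp v.ix v.lt) := by
      rw [eq_iff] at h; rw [adj_iff]; simp at h ⊢; exact h
    exact ⟨.cons ha .nil, by simp⟩

lemma walk_btw {N : ℕ} (u v : CV N) (h : u.ix ≤ v.ix) :
    ∃ p : (G N).Walk u v, ∀ w ∈ p.support, Btw u v w := by
  obtain ⟨p, hp⟩ := walk_to_sp u
  obtain ⟨q, hq⟩ := walk_to_sp v
  obtain ⟨r, hr⟩ := walk_sp u.ix v.ix h v.lt
  refine ⟨(p.append r).append q.reverse, ?_⟩
  intro w hw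
  rw [SimpleGraph.Walk.mem_support_append_iff, SimpleGraph.Walk.mem_support_append_iff,
    SimpleGraph.Walk.support_reverse, List.mem_reverse] at hw
  unfold Btw
  rcases hw with (hw | hw) | hw
  · rcases hp w hw with rfl | rfl <;> simp [h]
  · exact Or.inr (Or.inr (hr w hw))
  · rcases hq w hw with rfl | rfl <;> simp [h]

/-- discrete intermediate value theorem -/
lemma ivt {N : ℕ} {u v : CV N} (p : (G N).Walk u v) (i : ℕ) (hi : i < N)
    (h1 : u.ix ≤ i) (h2 : i ≤ v.ix) (h3 : u.ix < v.ix) : sp i hi ∈ p.support := by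
  induction p with
  | nil => omega
  | @cons a b c hab p ih =>
    rw [SimpleGraph.Walk.support_cons, List.mem_cons]
    rw [adj_iff] at hab
    by_cases hb : b.ix ≤ i ∧ b.ix < c.ix
    · exact Or.inr (ih hb.1 h2 hb.2)
    · rcases hab with ⟨ha, hb', h | h⟩ | ⟨h, h'⟩
      · by_cases hai : a.ix = i
        · left; rw [eq_iff]; simp [ha, hai]
        · right
          have : sp i hi = b := by rw [eq_iff]; simp [hb']; omega
          rw [this]; simp
      · omega
      · omega

lemma ivt' {N : ℕ} {u v : CV N} (p : (G N).Walk u v) (i : ℕ) (hi : i < N)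
    (h1 : v.ix ≤ i) (h2 : i ≤ u.ix) (h3 : v.ix < u.ix) : sp i hi ∈ p.support := by
  have := ivt p.reverse i hi h1 h2 h3
  simpa using this

lemma isTree {N : ℕ} (hN : 2 ≤ N) : (G N).IsTree := by
  have hc : (G N).Connected := by
    have : Nonempty (CV N) := ⟨sp 0 (by omega)⟩
    refine ⟨fun u v => ?_⟩
    rcases le_total u.ix v.ix with h | h
    · obtain ⟨p, -⟩ := walk_btw u v h; exact ⟨p⟩
    · obtain ⟨p, -⟩ := walk_btw v u h; exact ⟨p.reverse⟩
  rw [SimpleGraph.isTree_iff_connected_and_card]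
  refine ⟨hc, le_antisymm ?_ hc.card_vert_le_card_edgeSet_add_one⟩
  set r : CV N := sp 0 (by omega)
  let par : CV N → CV N := fun v =>
    if v.fl = true then sp v.ix v.lt else sp (v.ix - 1) (by have := v.lt; omega)
  have hsub : (G N).edgeSet ⊆ (fun v => s(v, par v)) '' ({r}ᶜ) := by
    intro e he
    induction e using Sym2.ind with
    | _ u v =>
    rw [SimpleGraph.mem_edgeSet] at he
    have key : ∀ u v : CV N, (u.fl = false ∧ v.fl = false ∧ u.ix + 1 = v.ix) ∨
        (u.ix = v.ix ∧ u.fl = false ∧ v.fl = true) → v ≠ r ∧ par v = u := by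
      intro u v h
      have hv := v.ok
      rw [Ne, eq_iff, eq_iff]
      rcases h with ⟨h1, h2, h3⟩ | ⟨h1, h2, h3⟩
      · simp [par, r, h1, h2]; omega
      · simp [par, r, h1, h2, h3]
    rw [adj_iff] at he
    have h2 : ((u.fl = false ∧ v.fl = false ∧ u.ix + 1 = v.ix) ∨
        (u.ix = v.ix ∧ u.fl = false ∧ v.fl = true)) ∨
        ((v.fl = false ∧ u.fl = false ∧ v.ix + 1 = u.ix) ∨
        (v.ix = u.ix ∧ v.fl = false ∧ u.fl = true)) := by
      cases hu : u.fl <;> cases hv : v.fl <;> simp [hu, hv] at he ⊢ <;> omega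
    rcases h2 with h2 | h2
    · obtain ⟨h3, h4⟩ := key _ _ h2
      exact ⟨v, h3, by simp [h4, Sym2.eq_swap]⟩
    · obtain ⟨h3, h4⟩ := key _ _ h2
      exact ⟨u, h3, by simp [h4]⟩
  have h1 := (Set.ncard_le_ncard hsub (Set.toFinite _)).trans (Set.ncard_image_le (Set.toFinite _))
  have h2 := Set.ncard_add_ncard_compl ({r} : Set (CV N))
  rw [Set.ncard_singleton] at h2
  rw [Nat.card_coe_set_eq]
  omega

lemma path_sub {N : ℕ} (hN : 2 ≤ N) {u v : CV N} (p q : (G N).Walk u v) (hp : p.IsPath) :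
    p.support ⊆ q.support := by
  classical
  have := (isTree hN).isAcyclic.path_unique ⟨p, hp⟩ ⟨q.bypass, q.bypass_isPath⟩
  have h : p = q.bypass := congrArg Subtype.val this
  rw [h]
  exact q.support_bypass_subset

lemma nbr_lb_zero {N : ℕ} (v : CV N) (hN : 2 ≤ N) (hv : v = lb v.ix v.lt) :
    ((G N).neighborSet v).ncard = 1 := by
  have hlt := v.lt
  rw [eq_iff] at hv
  simp at hv
  rw [Set.ncard_eq_one]
  by_cases h : 0 < v.ix ∧ v.ix + 1 < N
  · refine ⟨sp v.ix v.lt, ?_⟩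
    ext w
    have := w.ok
    simp only [SimpleGraph.mem_neighborSet, adj_iff, Set.mem_singleton_iff, eq_iff, sp_ix, sp_fl, hv]
    cases hw : w.fl <;> simp [hw, h] <;> omega
  · by_cases h0 : v.ix = 0
    · refine ⟨sp 1 (by omega), ?_⟩
      ext w
      have := w.ok
      simp only [SimpleGraph.mem_neighborSet, adj_iff, Set.mem_singleton_iff, eq_iff, sp_ix, sp_fl, hv]
      cases hw : w.fl <;> simp [hw, h0] at this ⊢ <;> omega
    · have : v.ix + 1 = N := by omega
      refine ⟨sp (v.ix - 1) (by omega), ?_⟩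
      ext w
      have := w.ok
      have := w.lt
      simp only [SimpleGraph.mem_neighborSet, adj_iff, Set.mem_singleton_iff, eq_iff, sp_ix, sp_fl, hv]
      cases hw : w.fl <;> simp [hw, h] at * <;> omega

lemma nbr_sp {N : ℕ} (v : CV N) (hv : v ≠ lb v.ix v.lt) :
    ∃ (h0 : 0 < v.ix) (h1 : v.ix + 1 < N), v.fl = false ∧
      (G N).neighborSet v = {lb v.ix v.lt, sp (v.ix - 1) (by omega), sp (v.ix + 1) h1} := by
  have hlt := v.lt
  have hok := v.ok
  rw [Ne, eq_iff] at hv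
  simp at hv
  have h : 0 < v.ix ∧ v.ix + 1 < N := by
    cases hf : v.fl <;> simp_all
  have hf : v.fl = false := by
    cases hf : v.fl <;> simp_all
  refine ⟨h.1, h.2, hf, ?_⟩
  ext w
  have := w.ok
  simp only [SimpleGraph.mem_neighborSet, adj_iff, Set.mem_insert_iff, Set.mem_singleton_iff,
    eq_iff, sp_ix, sp_fl, lb_ix, lb_fl, hf]
  cases hw : w.fl <;> simp [hw, h] <;> omega

lemma ncard_nbr_sp {N : ℕ} (v : CV N) (hv : v ≠ lb v.ix v.lt) :
    ((G N).neighborSet v).ncard = 3 := by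
  obtain ⟨h0, h1, h2, h3⟩ := nbr_sp v hv
  rw [h3, Set.ncard_eq_three]
  refine ⟨_, _, _, ?_, ?_, ?_, rfl⟩ <;> rw [Ne, eq_iff] <;> simp <;> omega

end CV

/-- The caterpillar tree with taxa in the order given by `e`. -/
def cat {X : Type} {N : ℕ} (hN : 2 ≤ N) (e : X ≃ Fin N) : UTree X where
  V := CV N
  finV := inferInstance
  g := CV.G N
  isTree := CV.isTree hN
  label := fun x => CV.lb (e x) (e x).2
  label_inj := by
    intro x y h
    rw [CV.eq_iff] at h
    exact e.injective (Fin.ext h.1)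
  leaf_iff := by
    have hr : ∀ v : CV N, v ∈ Set.range (fun x : X => CV.lb (N := N) (e x) (e x).2) ↔
        v = CV.lb v.ix v.lt := by
      intro v
      constructor
      · rintro ⟨x, rfl⟩; rfl
      · intro h; exact ⟨e.symm ⟨v.ix, v.lt⟩, by rw [h]; simp⟩
    intro v
    rw [hr]
    constructor
    · intro h
      by_contra hv
      rw [CV.ncard_nbr_sp v hv] at h; omega
    · exact CV.nbr_lb_zero v hN
  internal_deg := by
    intro v hv
    refine CV.ncard_nbr_sp v fun h => hv ?_
    exact ⟨e.symm ⟨v.ix, v.lt⟩, by rw [h]; simp⟩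

lemma mem_rev {V : Type} {G : SimpleGraph V} {u v w : V} (p : G.Walk u v) :
    w ∈ p.reverse.support ↔ w ∈ p.support := by simp

section catlemmas

variable {X : Type} {N : ℕ} (hN : 2 ≤ N) (e : X ≃ Fin N) (B : Set X)

lemma span_iff (v : CV N) : v ∈ (cat hN e).spanSet B ↔
    (∃ x ∈ B, v = CV.lb (e x) (e x).2) ∨
    (v.fl = false ∧ ∃ x ∈ B, ∃ y ∈ B, e x < e y ∧ (e x : ℕ) ≤ v.ix ∧ v.ix ≤ (e y : ℕ)) := by
  constructor
  · rintro ⟨x, hx, y, hy, p, hp, hv⟩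
    have main : ∀ x ∈ B, ∀ y ∈ B, ∀ p : (CV.G N).Walk (CV.lb (e x) (e x).2) (CV.lb (e y) (e y).2),
        p.IsPath → v ∈ p.support → e x ≤ e y → (∃ x ∈ B, v = CV.lb (e x) (e x).2) ∨
        (v.fl = false ∧ ∃ x ∈ B, ∃ y ∈ B, e x < e y ∧ (e x : ℕ) ≤ v.ix ∧ v.ix ≤ (e y : ℕ)) := by
      intro x hx y hy p hp hv hxy
      rcases hxy.eq_or_lt with h | h
      · have := e.injective h
        subst this
        rw [SimpleGraph.Walk.isPath_iff_eq_nil] at hp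
        subst hp
        simp at hv
        exact Or.inl ⟨x, hx, hv⟩
      · obtain ⟨q, hq⟩ := CV.walk_btw (CV.lb (e x) (e x).2) (CV.lb (e y) (e y).2) hxy
        rcases hq v (CV.path_sub hN p q hp hv) with h1 | h1 | h1
        · exact Or.inl ⟨x, hx, h1⟩
        · exact Or.inl ⟨y, hy, h1⟩
        · exact Or.inr ⟨h1.1, x, hx, y, hy, h, h1.2⟩
    rcases le_total (e x) (e y) with h | h
    · exact main x hx y hy p hp hv h
    · exact main y hy x hx p.reverse hp.reverse
        ((mem_rev _).2 hv) h
  · rintro (⟨x, hx, rfl⟩ | ⟨hf, x, hx, y, hy, hxy, h1, h2⟩)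
    · exact ⟨x, hx, x, hx, .nil, by simp, List.mem_singleton.2 rfl⟩
    · obtain ⟨p, hp⟩ := (CV.isTree hN).existsUnique_path (CV.lb (e x) (e x).2)
        (CV.lb (e y) (e y).2) |>.exists
      refine ⟨x, hx, y, hy, p, hp, ?_⟩
      have := CV.ivt p v.ix v.lt h1 h2 hxy
      have hv : v = CV.sp v.ix v.lt := by rw [CV.eq_iff]; simp [hf]
      rw [hv]; exact this

lemma keep_iff (v : CV N) : v ∈ (cat hN e).keepSet B ↔
    (∃ x ∈ B, v = CV.lb (e x) (e x).2) ∨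
    (v.fl = false ∧ ∃ z ∈ B, (e z : ℕ) = v.ix ∧ ∃ x ∈ B, ∃ y ∈ B, e x < e z ∧ e z < e y) := by
  constructor
  · rintro ⟨h1, ⟨x, hx, rfl⟩ | h2⟩
    · exact Or.inl ⟨x, hx, rfl⟩
    by_cases hv : v = CV.lb v.ix v.lt
    · exfalso
      have h3 : ((cat hN e).g.neighborSet v).ncard = 1 := CV.nbr_lb_zero v hN hv
      have h4 : ((cat hN e).g.neighborSet v ∩ (cat hN e).spanSet B).ncard ≤
        ((cat hN e).g.neighborSet v).ncard :=
        Set.ncard_le_ncard Set.inter_subset_left (Set.toFinite (α := CV N) _)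
      omega
    · obtain ⟨h0, h1', hf, hn⟩ := CV.nbr_sp v hv
      have hn' : (cat hN e).g.neighborSet v = ({CV.lb v.ix v.lt, CV.sp (v.ix - 1) (by omega),
        CV.sp (v.ix + 1) h1'} : Set (CV N)) := hn
      rw [hn'] at h2
      have hfin : ∀ a b c : CV N, ∀ S : Set (CV N), 3 ≤ (({a, b, c} : Set (CV N)) ∩ S).ncard →
          a ∈ S ∧ b ∈ S ∧ c ∈ S := by
        intro a b c S h
        have h5 : ∀ a b c : CV N, 3 ≤ (({a, b, c} : Set (CV N)) ∩ S).ncard → a ∈ S := by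
          intro a b c h
          by_contra hS
          have : ({a, b, c} : Set (CV N)) ∩ S ⊆ {b, c} := by
            rintro w ⟨hw, hw'⟩
            rcases hw with rfl | hw
            · exact absurd hw' hS
            · exact hw
          have := Set.ncard_le_ncard this (Set.toFinite _)
          have := Set.ncard_insert_le b {c}
          have := Set.ncard_singleton c
          omega
        refine ⟨h5 a b c h, h5 b a c ?_, h5 c a b ?_⟩
        · rwa [Set.insert_comm]
        · rwa [Set.insert_comm, Set.pair_comm c b]
      obtain ⟨ha, hb, hc⟩ := hfin _ _ _ _ h2
      have ha := (span_iff hN e B _).1 ha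
      have hb := (span_iff hN e B _).1 hb
      have hc := (span_iff hN e B _).1 hc
      right
      refine ⟨hf, ?_⟩
      have ha' : ∃ z ∈ B, (e z : ℕ) = v.ix := by
        rcases ha with ⟨z, hz, h⟩ | h
        · rw [CV.eq_iff] at h; exact ⟨z, hz, h.1.symm⟩
        · have := h.1; simp at this; omega
      obtain ⟨z, hz, hzv⟩ := ha'
      refine ⟨z, hz, hzv, ?_⟩
      have hb' : ∃ x ∈ B, (e x : ℕ) < e z := by
        rcases hb with ⟨x, hx, h⟩ | ⟨-, x, hx, -, -, -, h, -⟩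
        · rw [CV.eq_iff] at h; refine ⟨x, hx, ?_⟩; simp at h; omega
        · refine ⟨x, hx, ?_⟩; simp at h; omega
      have hc' : ∃ y ∈ B, (e z : ℕ) < e y := by
        rcases hc with ⟨x, hx, h⟩ | ⟨-, -, -, x, hx, -, -, h⟩
        · rw [CV.eq_iff] at h; refine ⟨x, hx, ?_⟩; simp at h; omega
        · refine ⟨x, hx, ?_⟩; simp at h; omega
      obtain ⟨x, hx, hxz⟩ := hb'
      obtain ⟨y, hy, hyz⟩ := hc'
      exact ⟨x, hx, y, hy, hxz, hyz⟩
  · rintro (⟨x, hx, rfl⟩ | ⟨hf, z, hz, hzv, x, hx, y, hy, hxz, hzy⟩)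
    · exact ⟨(span_iff hN e B _).2 (Or.inl ⟨x, hx, rfl⟩), Or.inl ⟨x, hx, rfl⟩⟩
    · have hxz' : (e x : ℕ) < e z := hxz
      have hzy' : (e z : ℕ) < e y := hzy
      have hyN := (e y).2
      have hv : v ≠ CV.lb v.ix v.lt := by
        rw [Ne, CV.eq_iff]; simp [hf]; omega
      refine ⟨(span_iff hN e B _).2 (Or.inr ⟨hf, x, hx, y, hy, hxz.trans hzy, by omega, by omega⟩),
        Or.inr ?_⟩
      have h3 : ((cat hN e).g.neighborSet v).ncard = 3 := CV.ncard_nbr_sp v hv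
      obtain ⟨h0, h1', hf, hn⟩ := CV.nbr_sp v hv
      have hn' : (cat hN e).g.neighborSet v = ({CV.lb v.ix v.lt, CV.sp (v.ix - 1) (by omega),
        CV.sp (v.ix + 1) h1'} : Set (CV N)) := hn
      rw [Set.inter_eq_left.2, h3]
      rw [hn']
      have hxy := hxz.trans hzy
      rintro w (rfl | rfl | rfl)
      · exact (span_iff hN e B _).2 (Or.inl ⟨z, hz, by simp [hzv]⟩)
      · exact (span_iff hN e B _).2 (Or.inr ⟨rfl, x, hx, y, hy, hxy, by simp; omega, by simp; omega⟩)
      · exact (span_iff hN e B _).2 (Or.inr ⟨rfl, x, hx, y, hy, hxy, by simp; omega, by simp; omega⟩)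

lemma lb_not_span (x : X) (hx : x ∉ B) : (cat hN e).label x ∉ (cat hN e).spanSet B := by
  change CV.lb (e x) (e x).2 ∉ _
  rw [span_iff]
  rintro (⟨y, hy, h⟩ | ⟨hf, y, hy, z, hz, hyz, h1, h2⟩)
  · have := (cat hN e).label_inj h
    exact hx (this ▸ hy)
  · have h3 : (e y : ℕ) ≠ e x := fun h => hx (e.injective (Fin.ext h) ▸ hy)
    have h4 : (e z : ℕ) ≠ e x := fun h => hx (e.injective (Fin.ext h) ▸ hz)
    have := (e z).2
    simp at hf h1 h2
    omega

lemma span_singleton (x : X) : (cat hN e).spanSet {x} = {(cat hN e).label x} := by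
  ext v
  refine (span_iff hN e _ v).trans ?_
  simp only [Set.mem_singleton_iff, exists_eq_left, lt_self_iff_false, false_and, and_false, or_false]
  rfl

lemma keep_singleton (x : X) : (cat hN e).keepSet {x} = {(cat hN e).label x} := by
  ext v
  refine (keep_iff hN e _ v).trans ?_
  simp only [Set.mem_singleton_iff, exists_eq_left, lt_self_iff_false, false_and, and_false, or_false]
  rfl

/-- The restriction of a caterpillar to `B` is the caterpillar of the induced order. -/
lemma key {M : ℕ} (hM : 2 ≤ M) (b : Fin M → X) (hb : StrictMono fun i => e (b i))
    (hB : Set.range b = B) : ∃ φ : CV M → CV N, Function.Injective φ ∧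
      (∀ i : Fin M, φ (CV.lb i i.2) = CV.lb (e (b i)) (e (b i)).2) ∧
      Set.range φ = (cat hN e).keepSet B ∧
      ∀ u v : CV M, (CV.G M).Adj u v ↔ (cat hN e).restAdj B (φ u) (φ v) := by
  classical
  let ι : CV M → Fin M := fun v => ⟨v.ix, v.lt⟩
  let f : CV M → Fin N := fun v => e (b (ι v))
  let φ : CV M → CV N := fun v => if v = CV.lb v.ix v.lt then CV.lb (f v) (f v).2
    else CV.sp (f v) (f v).2
  have hmono : ∀ {u v : CV M}, (f u : ℕ) < f v ↔ u.ix < v.ix := fun {u v} => hb.lt_iff_lt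
  have hmle : ∀ {u v : CV M}, (f u : ℕ) ≤ f v ↔ u.ix ≤ v.ix := fun {u v} => hb.le_iff_le
  have hBm : ∀ i, b i ∈ B := fun i => hB ▸ Set.mem_range_self i
  have φix : ∀ v, (φ v).ix = f v := by
    intro v; simp only [φ]; split_ifs <;> rfl
  have int : ∀ v : CV M, 0 < v.ix → v.ix + 1 < M → 0 < (f v : ℕ) ∧ (f v : ℕ) + 1 < N := by
    intro v h0 h1
    have h2 : e (b ⟨0, by omega⟩) < e (b (ι v)) := hb (show (⟨0, by omega⟩ : Fin M) < ι v from h0)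
    have h3 : e (b (ι v)) < e (b ⟨M - 1, by omega⟩) :=
      hb (show ι v < (⟨M-1, by omega⟩ : Fin M) from (by show v.ix < M - 1; omega))
    have h2' : (e (b ⟨0, by omega⟩) : ℕ) < e (b (ι v)) := h2
    have h3' : (e (b (ι v)) : ℕ) < e (b ⟨M - 1, by omega⟩) := h3
    have := (e (b ⟨M - 1, by omega⟩)).2
    simp only [f]
    omega
  have φint : ∀ v : CV M, 0 < v.ix → v.ix + 1 < M → (φ v).fl = v.fl := by
    intro v h0 h1
    have := int v h0 h1
    simp only [φ]
    split_ifs with h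
    · rw [CV.eq_iff] at h; simp at h; simp [h]; simp [*]
    · obtain ⟨-, -, h3, -⟩ := CV.nbr_sp v h
      simp [h3]
  have φext : ∀ v : CV M, ¬ (0 < v.ix ∧ v.ix + 1 < M) → φ v = CV.lb (f v) (f v).2 := by
    intro v h
    simp only [φ]
    rw [if_pos]
    by_contra h'
    obtain ⟨h0, h1, -⟩ := CV.nbr_sp v h'
    exact h ⟨h0, h1⟩
  have φlb : ∀ i : Fin M, φ (CV.lb i i.2) = CV.lb (e (b i)) (e (b i)).2 := by
    intro i
    simp only [φ]
    exact if_pos rfl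
  have φinj : Function.Injective φ := by
    intro u v h
    rw [CV.eq_iff, φix, φix] at h
    have hix : u.ix = v.ix := le_antisymm (hmle.1 h.1.le) (hmle.1 h.1.ge)
    by_cases hint : 0 < u.ix ∧ u.ix + 1 < M
    · rw [CV.eq_iff]
      rw [φint u hint.1 hint.2, φint v (by omega) (by omega)] at h
      exact ⟨hix, h.2⟩
    · have hu := u.ok
      have hv := v.ok
      rw [CV.eq_iff]
      refine ⟨hix, ?_⟩
      have hu' : u.fl = false := by
        cases h1 : u.fl
        · rfl
        · exact absurd (hu h1) hint
      have hv' : v.fl = false := by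
        cases h1 : v.fl
        · rfl
        · exact absurd (hv h1) (by omega)
      rw [hu', hv']
  have keepsp : ∀ v : CV M, 0 < v.ix → v.ix + 1 < M →
      CV.sp (f v) (f v).2 ∈ (cat hN e).keepSet B := by
    intro v h0 h1
    rw [keep_iff]
    refine Or.inr ⟨rfl, b (ι v), hBm _, rfl, b ⟨0, by omega⟩, hBm _, b ⟨M-1, by omega⟩, hBm _, ?_, ?_⟩
    · exact hb (show (⟨0, by omega⟩ : Fin M) < ι v from h0)
    · exact hb (show ι v < (⟨M-1, by omega⟩ : Fin M) from (by show v.ix < M - 1; omega))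
  have φkeep : ∀ v, φ v ∈ (cat hN e).keepSet B := by
    intro v
    by_cases h : v = CV.lb v.ix v.lt
    · have : φ v = CV.lb (f v) (f v).2 := by simp only [φ]; rw [if_pos h]
      rw [this, keep_iff]
      exact Or.inl ⟨b (ι v), hBm _, rfl⟩
    · obtain ⟨h0, h1, -⟩ := CV.nbr_sp v h
      have : φ v = CV.sp (f v) (f v).2 := by simp only [φ]; rw [if_neg h]
      rw [this]
      exact keepsp v h0 h1
  have φrange : Set.range φ = (cat hN e).keepSet B := by
    apply Set.Subset.antisymm
    · rintro _ ⟨v, rfl⟩; exact φkeep v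
    · intro w hw
      have hw := (keep_iff hN e B w).1 hw
      rcases hw with ⟨x, hx, rfl⟩ | ⟨hf, z, hz, hzw, x, hx, y, hy, h1, h2⟩
      · rw [← hB] at hx
        obtain ⟨i, rfl⟩ := hx
        exact ⟨_, φlb i⟩
      · rw [← hB] at hx hy hz
        obtain ⟨i, rfl⟩ := hx
        obtain ⟨j, rfl⟩ := hy
        obtain ⟨l, rfl⟩ := hz
        have h1 : i < l := hb.lt_iff_lt.1 h1
        have h2 : l < j := hb.lt_iff_lt.1 h2
        have h1' : (i : ℕ) < l := h1
        have h2' : (l : ℕ) < j := h2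
        have := j.2
        refine ⟨CV.sp l l.2, ?_⟩
        apply (CV.eq_iff _ _).2
        rw [φix, φint _ (by simp; omega) (by simp; omega)]
        exact ⟨hzw, hf.symm⟩
  have spkeep : ∀ v : CV M, 0 < v.ix → v.ix + 1 < M → CV.sp (f v) (f v).2 = φ (CV.sp v.ix v.lt) := by
    intro v h0 h1
    rw [CV.eq_iff, φix, φint _ (by simpa using h0) (by simpa using h1)]
    exact ⟨rfl, rfl⟩
  refine ⟨φ, φinj, φlb, φrange, ?_⟩
  -- forward direction, one orientation
  have fwd : ∀ u v : CV M, (CV.G M).Adj u v → u.ix ≤ v.ix →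
      ∃ p : (CV.G N).Walk (φ u) (φ v), p.IsPath ∧ (∀ w ∈ p.support, w ∈ (cat hN e).spanSet B) ∧
        ∀ w ∈ p.support, w ∈ (cat hN e).keepSet B → w = φ u ∨ w = φ v := by
    intro u v ha huv
    have ha' := (CV.adj_iff u v).1 ha
    obtain ⟨p, hp⟩ := CV.walk_btw (φ u) (φ v) (by rw [φix, φix]; exact hmle.2 huv)
    refine ⟨p.bypass, p.bypass_isPath, ?_, ?_⟩
    · intro w hw
      rcases hp w (p.support_bypass_subset_support hw) with rfl | rfl | ⟨hf, h1, h2⟩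
      · exact (φkeep _).1
      · exact (φkeep _).1
      · rcases huv.eq_or_lt with h | h
        · -- both at the same interior position
          have hint : 0 < u.ix ∧ u.ix + 1 < M := by
            have := u.ok; have := v.ok
            rcases ha' with h' | ⟨_, h'⟩
            · omega
            · cases h1 : u.fl <;> cases h2 : v.fl <;> simp_all
          have hfe : f u = f v := by simp only [f, ι]; congr 2; exact Fin.ext h
          have : w = CV.sp (f u) (f u).2 := by
            rw [CV.eq_iff]
            rw [φix] at h1 h2
            rw [← hfe] at h2
            exact ⟨le_antisymm h2 h1, hf⟩
          rw [this]
          exact (keepsp u hint.1 hint.2).1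
        · refine (span_iff hN e B w).2 (Or.inr ⟨hf, b (ι u), hBm _, b (ι v), hBm _, hb h, ?_, ?_⟩)
          · rw [φix] at h1; exact h1
          · rw [φix] at h2; exact h2
    · intro w hw hk
      rcases hp w (p.support_bypass_subset_support hw) with rfl | rfl | ⟨hf, h1, h2⟩
      · exact Or.inl rfl
      · exact Or.inr rfl
      · have hk' : w ∈ Set.range φ := by rw [φrange]; exact hk
        obtain ⟨t, rfl⟩ := hk'
        rw [φix, φix] at h1
        rw [φix, φix] at h2
        have h1 := hmle.1 h1
        have h2 := hmle.1 h2
        have htok := t.ok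
        have huok := u.ok
        have hvok := v.ok
        have htlt := t.lt
        have : t = u ∨ t = v := by
          rw [CV.eq_iff, CV.eq_iff]
          have htf : (0 < t.ix ∧ t.ix + 1 < M) → t.fl = false := by
            intro h; rw [φint t h.1 h.2] at hf; exact hf
          have htf' : t.fl = false := by
            cases h : t.fl
            · rfl
            · exact absurd (htf (htok h)) (by simp [h])
          rcases ha' with ⟨h3, h4, h5⟩ | ⟨h3, h4⟩
          · simp only [h3, h4, htf', and_true]; omega
          · cases h6 : u.fl <;> cases h7 : v.fl <;> simp [h6, h7, htf'] at h4 ⊢ <;> omega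
        rcases this with rfl | rfl
        · exact Or.inl rfl
        · exact Or.inr rfl
  have bwd : ∀ u v : CV M, u.ix < v.ix → ∀ p : (CV.G N).Walk (φ u) (φ v),
        (∀ w ∈ p.support, w ∈ (cat hN e).keepSet B → w = φ u ∨ w = φ v) →
        (CV.G M).Adj u v := by
    intro u v huv p hp
    have hlt : (φ u).ix < (φ v).ix := by rw [φix, φix]; exact hmono.2 huv
    have hh : ∀ t : CV M, u.ix ≤ t.ix → t.ix ≤ v.ix → 0 < t.ix → t.ix + 1 < M → t.fl = false →
        t = u ∨ t = v := by
      intro t h1 h2 h3 h4 h5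
      have hs : CV.sp (f t) (f t).2 ∈ p.support :=
        CV.ivt p _ _ (by rw [φix]; exact hmle.2 h1) (by rw [φix]; exact hmle.2 h2) hlt
      have := hp _ hs (keepsp t h3 h4)
      have ht : t = CV.sp t.ix t.lt := by rw [CV.eq_iff]; simp [h5]
      rw [spkeep t h3 h4, ← ht] at this
      rcases this with h | h
      · exact Or.inl (φinj h)
      · exact Or.inr (φinj h)
    have hu := u.ok
    have hv := v.ok
    have hvlt := v.lt
    have huf : u.fl = false := by
      cases h : u.fl
      · rfl
      · obtain ⟨h1, h2⟩ := hu h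
        rcases hh (CV.sp u.ix u.lt) (by simp) (by simpa using huv.le) (by simpa) (by simpa) rfl with h3 | h3
        · rw [CV.eq_iff] at h3; simp [h] at h3
        · rw [CV.eq_iff] at h3; simp at h3; omega
    have hvf : v.fl = false := by
      cases h : v.fl
      · rfl
      · obtain ⟨h1, h2⟩ := hv h
        rcases hh (CV.sp v.ix v.lt) (by simpa using huv.le) (by simp) (by simpa) (by simpa) rfl with h3 | h3
        · rw [CV.eq_iff] at h3; simp at h3; omega
        · rw [CV.eq_iff] at h3; simp [h] at h3
    rw [CV.adj_iff]
    refine Or.inl ⟨huf, hvf, Or.inl ?_⟩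
    by_contra hne
    rcases hh (CV.sp (u.ix + 1) (by omega)) (by simp) (by simp; omega) (by simp) (by simp; omega) rfl
      with h3 | h3
    · rw [CV.eq_iff] at h3; simp at h3
    · rw [CV.eq_iff] at h3; simp at h3; omega
  intro u v
  constructor
  · intro ha
    refine ⟨φkeep u, φkeep v, fun h => ha.ne (φinj h), ?_⟩
    rcases le_total u.ix v.ix with h | h
    · exact fwd u v ha h
    · obtain ⟨p, h1, h2, h3⟩ := fwd v u ha.symm h
      refine ⟨p.reverse, h1.reverse, ?_, ?_⟩
      · intro w hw
        exact h2 w ((mem_rev _).1 hw)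
      · intro w hw hk
        exact (h3 w ((mem_rev _).1 hw) hk).symm
  · rintro ⟨-, -, hne, p, -, -, hp⟩
    have hne' : u ≠ v := fun h => hne (congrArg φ h)
    rcases lt_trichotomy u.ix v.ix with h | h | h
    · exact bwd u v h p hp
    · rw [CV.adj_iff]
      refine Or.inr ⟨h, fun h' => hne' ?_⟩
      rw [CV.eq_iff]; exact ⟨h, h'⟩
    · refine (bwd v u h p.reverse ?_).symm
      intro w hw hk
      exact (hp w ((mem_rev _).1 hw) hk).symm

end catlemmas

lemma restEq_of_mono {X : Type} {N N' M : ℕ} (hN : 2 ≤ N) (hN' : 2 ≤ N') (hM : 2 ≤ M)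
    (e : X ≃ Fin N) (e' : X ≃ Fin N') (B : Set X) (b : Fin M → X)
    (hb : StrictMono fun i => e (b i)) (hb' : StrictMono fun i => e' (b i))
    (hB : Set.range b = B) : UTree.restEq (cat hN e) (cat hN' e') B := by
  obtain ⟨φ, h1, h2, h3, h4⟩ := key hN e B hM b hb hB
  obtain ⟨φ', h1', h2', h3', h4'⟩ := key hN' e' B hM b hb' hB
  have : Nonempty (CV M) := ⟨CV.sp 0 (by omega)⟩
  have hinv : ∀ u, Function.invFun φ (φ u) = u := Function.leftInverse_invFun h1
  refine ⟨fun v => φ' (Function.invFun φ v), ⟨?_, ?_, ?_⟩, ?_, ?_⟩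
  · intro v _
    rw [← h3']
    exact ⟨_, rfl⟩
  · intro u hu v hv h
    rw [← h3] at hu hv
    obtain ⟨u, rfl⟩ := hu
    obtain ⟨v, rfl⟩ := hv
    have h := h1' h
    rw [hinv, hinv] at h
    rw [h]
  · intro w hw
    rw [← h3'] at hw
    obtain ⟨w, rfl⟩ := hw
    refine ⟨φ w, ?_, ?_⟩
    · rw [← h3]; exact ⟨_, rfl⟩
    · show φ' (Function.invFun φ (φ w)) = _
      rw [hinv]
  · intro x hx
    rw [← hB] at hx
    obtain ⟨i, rfl⟩ := hx
    show φ' (Function.invFun φ (CV.lb (e (b i)) (e (b i)).2)) = CV.lb (e' (b i)) (e' (b i)).2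
    rw [← h2, hinv, h2']
  · intro u v hu hv
    rw [← h3] at hu hv
    obtain ⟨u, rfl⟩ := hu
    obtain ⟨v, rfl⟩ := hv
    show _ ↔ (cat hN' e').restAdj B (φ' (Function.invFun φ (φ u))) (φ' (Function.invFun φ (φ v)))
    rw [hinv, hinv, ← h4, ← h4']

lemma restEq_singleton {X : Type} {N N' : ℕ} (hN : 2 ≤ N) (hN' : 2 ≤ N')
    (e : X ≃ Fin N) (e' : X ≃ Fin N') (x : X) : UTree.restEq (cat hN e) (cat hN' e') {x} := by
  refine ⟨fun _ => (cat hN' e').label x, ?_, ?_, ?_⟩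
  · rw [keep_singleton, keep_singleton]
    simp
  · rintro y rfl; rfl
  · intro u v hu hv
    rw [keep_singleton] at hu hv
    constructor
    · rintro ⟨-, -, h, -⟩
      exact absurd (hu.trans hv.symm) h
    · rintro ⟨-, -, h, -⟩
      exact absurd rfl h

lemma enum {X : Type} {N : ℕ} (e : X ≃ Fin N) (B : Set X) :
    ∃ (M : ℕ) (b : Fin M → X), StrictMono (fun i => e (b i)) ∧ Set.range b = B := by
  classical
  let P : Finset (Fin N) := Finset.univ.filter fun i => e.symm i ∈ B
  refine ⟨P.card, fun i => e.symm (P.orderEmbOfFin rfl i), ?_, ?_⟩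
  · intro i j h
    simpa using h
  · ext x
    constructor
    · rintro ⟨i, rfl⟩
      have := P.orderEmbOfFin_mem rfl i
      exact (Finset.mem_filter.1 this).2
    · intro hx
      have : e x ∈ Set.range (P.orderEmbOfFin rfl) := by
        rw [Finset.range_orderEmbOfFin]; simpa [P] using hx
      obtain ⟨i, hi⟩ := this
      exact ⟨i, by simp [hi]⟩

lemma btw_bd {N : ℕ} {u v w : CV N} (h : CV.Btw u v w) (huv : u.ix ≤ v.ix) :
    u.ix ≤ w.ix ∧ w.ix ≤ v.ix := by
  rcases h with rfl | rfl | h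
  · exact ⟨le_rfl, huv⟩
  · exact ⟨huv, le_rfl⟩
  · exact h.2

lemma no_restEq {X : Type} {N N' : ℕ} (hN : 2 ≤ N) (hN' : 2 ≤ N')
    (e : X ≃ Fin N) (e' : X ≃ Fin N') (B : Set X) (a b c y : X) (ha : a ∈ B) (hb : b ∈ B)
    (hc : c ∈ B) (hy : y ∈ B) (h1 : e a < e b) (h2 : e b < e c) (h3 : e c < e y)
    (h4 : e' a < e' b) (h5 : e' b < e' c) (h6 : e' y < e' a) :
    ¬ UTree.restEq (cat hN e) (cat hN' e') B := by
  rintro ⟨θ, hθ, hθl, hθa⟩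
  obtain ⟨M, f, hf, hfB⟩ := enum e B
  obtain ⟨M', f', hf', hfB'⟩ := enum e' B
  have ex : ∀ x ∈ B, ∃ i, f i = x := fun x hx => by rw [← hfB] at hx; exact hx
  have ex' : ∀ x ∈ B, ∃ i, f' i = x := fun x hx => by rw [← hfB'] at hx; exact hx
  obtain ⟨ia, hia⟩ := ex a ha
  obtain ⟨ib, hib⟩ := ex b hb
  obtain ⟨ic, hic⟩ := ex c hc
  obtain ⟨iy, hiy⟩ := ex y hy
  obtain ⟨ja, hja⟩ := ex' a ha
  obtain ⟨jb, hjb⟩ := ex' b hb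
  obtain ⟨jc, hjc⟩ := ex' c hc
  obtain ⟨jy, hjy⟩ := ex' y hy
  rw [← hia, ← hib] at h1
  rw [← hib, ← hic] at h2
  rw [← hic, ← hiy] at h3
  rw [← hja, ← hjb] at h4
  rw [← hjb, ← hjc] at h5
  rw [← hjy, ← hja] at h6
  have k1 : (ia : ℕ) < ib := hf.lt_iff_lt.1 h1
  have k2 : (ib : ℕ) < ic := hf.lt_iff_lt.1 h2
  have k3 : (ic : ℕ) < iy := hf.lt_iff_lt.1 h3
  have k4 : (ja : ℕ) < jb := hf'.lt_iff_lt.1 h4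
  have k5 : (jb : ℕ) < jc := hf'.lt_iff_lt.1 h5
  have k6 : (jy : ℕ) < ja := hf'.lt_iff_lt.1 h6
  have := iy.2
  have := jc.2
  obtain ⟨φ, q1, q2, q3, q4⟩ := key hN e B (show 2 ≤ M by omega) f hf hfB
  obtain ⟨φ', q1', q2', q3', q4'⟩ := key hN' e' B (show 2 ≤ M' by omega) f' hf' hfB'
  have kp : ∀ u, φ u ∈ (cat hN e).keepSet B := fun u => by rw [← q3]; exact ⟨u, rfl⟩
  have hex : ∀ u : CV M, ∃ w : CV M', φ' w = θ (φ u) := by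
    intro u
    have := hθ.mapsTo (kp u)
    rw [← q3'] at this
    exact this
  choose ψ hψ using hex
  have ψinj : Function.Injective ψ := by
    intro u v h
    have h' : θ (φ u) = θ (φ v) := by rw [← hψ, ← hψ, h]
    exact q1 (hθ.injOn (kp u) (kp v) h')
  have ψadj : ∀ {u v : CV M}, (CV.G M).Adj u v → (CV.G M').Adj (ψ u) (ψ v) := by
    intro u v h
    rw [q4', hψ, hψ]
    exact (hθa _ _ (kp u) (kp v)).1 ((q4 u v).1 h)
  have ψl : ∀ i j, f i = f' j → ψ (CV.lb i i.2) = CV.lb j j.2 := by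
    intro i j hij
    apply q1'
    rw [hψ, q2, q2', ← hij]
    exact hθl (f i) (hfB ▸ ⟨i, rfl⟩)
  let H : CV.G M →g CV.G M' := ⟨ψ, ψadj⟩
  obtain ⟨p, hp⟩ := CV.walk_btw (CV.lb ia ia.2) (CV.lb ib ib.2) k1.le
  obtain ⟨q, hq⟩ := CV.walk_btw (CV.lb ic ic.2) (CV.lb iy iy.2) k3.le
  have ea : H (CV.lb ia ia.2) = CV.lb ja ja.2 := ψl _ _ (hia.trans hja.symm)
  have eb : H (CV.lb ib ib.2) = CV.lb jb jb.2 := ψl _ _ (hib.trans hjb.symm)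
  have ec : H (CV.lb ic ic.2) = CV.lb jc jc.2 := ψl _ _ (hic.trans hjc.symm)
  have ey : H (CV.lb iy iy.2) = CV.lb jy jy.2 := ψl _ _ (hiy.trans hjy.symm)
  have m1 : CV.sp jb jb.2 ∈ (p.map H).support :=
    CV.ivt _ _ _ (by rw [ea]; exact k4.le) (by rw [eb]; exact le_rfl) (by rw [ea, eb]; exact k4)
  have m2 : CV.sp jb jb.2 ∈ (q.map H).support :=
    CV.ivt' _ _ _ (by rw [ey]; simp; omega) (by rw [ec]; simp; omega)
      (by rw [ec, ey]; simp; omega)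
  rw [SimpleGraph.Walk.support_map, List.mem_map] at m1 m2
  obtain ⟨w1, hw1, e1⟩ := m1
  obtain ⟨w2, hw2, e2⟩ := m2
  have hw : w1 = w2 := ψinj (e1.trans e2.symm)
  have b1 := btw_bd (hp _ hw1) k1.le
  have b2 := btw_bd (hq _ hw2) k3.le
  rw [hw] at b1
  simp at b1 b2
  omega

lemma rank {Z : Type} [Finite Z] (pos : Z → ℕ) (hpos : Function.Injective pos) :
    ∃ e : Z ≃ Fin (Nat.card Z), ∀ x y, e x < e y ↔ pos x < pos y := by
  classical
  let _ : Fintype Z := Fintype.ofFinite Z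
  let _ : LinearOrder Z := LinearOrder.lift' pos hpos
  let o := Fintype.orderIsoFinOfCardEq Z (k := Nat.card Z) (Nat.card_eq_fintype_card).symm
  refine ⟨o.symm.toEquiv, fun x y => ?_⟩
  exact o.symm.lt_iff_lt

lemma consec {N : ℕ} {u v p q : CV N} (hu : u = CV.lb u.ix u.lt) (hv : v = CV.lb v.ix v.lt)
    (h : u.ix + 1 = v.ix) (hp : (CV.G N).Adj u p) (hq : (CV.G N).Adj v q) :
    p = q ∨ (CV.G N).Adj p q := by
  rw [CV.eq_iff] at hu hv
  simp at hu hv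
  rw [CV.adj_iff] at *
  rw [CV.eq_iff]
  have := p.ok
  have := q.ok
  have := p.lt
  have := q.lt
  have := v.lt
  by_cases h0 : 0 < u.ix <;> by_cases h1 : v.ix + 1 < N <;>
  cases h2 : p.fl <;> cases h3 : q.fl <;> simp [*] at * <;> omega

lemma sorted3 {n : ℕ} (s : Finset (Fin n)) (h : 2 < s.card) :
    ∃ a ∈ s, ∃ b ∈ s, ∃ c ∈ s, a < b ∧ b < c := by
  obtain ⟨a, ha, b, hb, c, hc, h1, h2, h3⟩ := Finset.two_lt_card.1 h
  rcases lt_or_gt_of_ne h1 with h1 | h1 <;> rcases lt_or_gt_of_ne h2 with h2 | h2 <;>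
    rcases lt_or_gt_of_ne h3 with h3 | h3
  · exact ⟨a, ha, b, hb, c, hc, h1, h3⟩
  · exact ⟨a, ha, c, hc, b, hb, h2, h3⟩
  · exact ⟨a, ha, b, hb, c, hc, h1, h3⟩
  · exact ⟨c, hc, a, ha, b, hb, h2, h1⟩
  · exact ⟨b, hb, a, ha, c, hc, h1, h2⟩
  · exact ⟨b, hb, a, ha, c, hc, h1, h2⟩
  · exact ⟨b, hb, c, hc, a, ha, h3, h2⟩
  · exact ⟨c, hc, b, hb, a, ha, h3, h1⟩

/-- Position of a taxon in the `j`-th caterpillar. -/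
def pos (k j : ℕ) : Fin (k + 1) ⊕ Fin (2 * k + 1) → ℕ
  | .inl i => if (i : ℕ) < j then i else i + (2 * k + 1)
  | .inr l => j + l

lemma pos_inj (k j : ℕ) : Function.Injective (pos k j) := by
  rintro (i | i) (l | l) h
  · have hi := i.2
    have hl := l.2
    simp only [pos] at h
    have : i = l := by apply Fin.ext; split_ifs at h <;> omega
    rw [this]
  · have hi := i.2
    have hl := l.2
    simp only [pos] at h
    split_ifs at h <;> omega
  · have hi := i.2
    have hl := l.2
    simp only [pos] at h
    split_ifs at h <;> omega
  · simp only [pos] at h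
    have : i = l := by apply Fin.ext; omega
    rw [this]

lemma cat_inj {X : Type} {N : ℕ} (hN : 2 ≤ N) (e e' : X ≃ Fin N)
    (h : cat hN e = cat hN e') : e = e' := by
  unfold cat at h
  have h := UTree.mk.inj h
  ext x
  have := congrFun (eq_of_heq h.2.2) x
  rw [CV.eq_iff] at this
  exact this.1

/-- **Tightness of the truncation length in `k` (unrooted).** For every `k ≥ 4` there
exist a finite taxon set `X`, a set `𝒯` of `t = k+2` unrooted binary phylogenetic trees
on `X`, and a common `m`-chain `x` of `𝒯` with `m = 2k+1`, such that every unrooted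
agreement forest for `𝒯` has size at least `k+1`, while the trees obtained by truncating
the chain to length `k−1` (restricting to `X ∖ {x_k, …, x_m}`) have an unrooted
agreement forest of size at most `k`. -/
theorem truncation_to_k_minus_one_not_safe_unrooted (k : ℕ) (hk : 4 ≤ k) :
    ∃ (X : Type) (_ : Finite X) (𝒯 : Set (UTree X)) (x : Fin (2 * k + 1) → X),
      𝒯.ncard = k + 2 ∧ UTree.IsCommonChain 𝒯 x ∧
      (∀ F, UTree.IsAgreementForest 𝒯 F → k + 1 ≤ F.ncard) ∧
      ∀ XC : Set X, XC = {a : X | ¬ ∃ i : Fin (2 * k + 1), k - 1 ≤ (i : ℕ) ∧ x i = a} →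
        ∃ 𝒯C : Set (UTree ↥XC), UTree.IsRestrictionFamily 𝒯 XC 𝒯C ∧
          ∃ F, UTree.IsAgreementForest 𝒯C F ∧ F.ncard ≤ k := by
  classical
  have hN : 2 ≤ Nat.card (Fin (k + 1) ⊕ Fin (2 * k + 1)) := by
    simp; omega
  choose E hE using fun j : Fin (k + 2) => rank (pos k j) (pos_inj k j)
  -- positions of non-chain taxa relative to the chain
  have left : ∀ (j : Fin (k + 2)) (i : Fin (k + 1)) (l : Fin (2 * k + 1)), (i : ℕ) < j →
      E j (.inl i) < E j (.inr l) := by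
    intro j i l h
    rw [hE]; simp only [pos, if_pos h]; omega
  have right : ∀ (j : Fin (k + 2)) (i : Fin (k + 1)) (l : Fin (2 * k + 1)), (j : ℕ) ≤ i →
      E j (.inr l) < E j (.inl i) := by
    intro j i l h
    have := l.2
    rw [hE]; simp only [pos, if_neg (not_lt.2 h)]; omega
  have chain : ∀ (j : Fin (k + 2)) (l l' : Fin (2 * k + 1)), l < l' →
      E j (.inr l) < E j (.inr l') := by
    intro j l l' h
    have h' : (l : ℕ) < l' := h
    rw [hE]; simp only [pos]; omega
  have Einj : Function.Injective fun j => cat hN (E j) := by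
    have : ∀ j j' : Fin (k + 2), j < j' → E j ≠ E j' := by
      intro j j' h he
      have h' : (j : ℕ) < j' := h
      have := j'.2
      have h1 := right j ⟨j, by omega⟩ ⟨0, by omega⟩ le_rfl
      have h2 := left j' ⟨j, by omega⟩ ⟨0, by omega⟩ h'
      rw [he] at h1
      exact lt_asymm h1 h2
    intro j j' h
    have h := cat_inj hN _ _ h
    rcases lt_trichotomy j j' with h1 | h1 | h1
    · exact absurd h (this _ _ h1)
    · exact h1
    · exact absurd h.symm (this _ _ h1)
  refine ⟨(Fin (k + 1) ⊕ Fin (2 * k + 1)), inferInstance, Set.range fun j => cat hN (E j), Sum.inr, ?_, ?_, ?_, ?_⟩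
  · rw [Set.ncard_range_of_injective Einj]; simp
  · refine ⟨by omega, Sum.inr_injective, ?_⟩
    rintro _ ⟨j, rfl⟩ l hl p q hp hq
    refine consec (u := CV.lb (E j (.inr ⟨l, by omega⟩)) (Fin.is_lt _))
      (v := CV.lb (E j (.inr ⟨l + 1, hl⟩)) (Fin.is_lt _)) rfl rfl ?_ hp hq
    simp only [CV.lb_ix]
    have h1 : (E j (.inr ⟨l, by omega⟩) : ℕ) < (E j (.inr ⟨l + 1, hl⟩)) :=
      chain j ⟨l, by omega⟩ ⟨l + 1, hl⟩ (by simp)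
    by_contra hne
    have h2 := (E j (.inr ⟨l + 1, hl⟩)).2
    let t : Fin (Nat.card (Fin (k + 1) ⊕ Fin (2 * k + 1))) := ⟨(E j (.inr ⟨l, by omega⟩) : ℕ) + 1, by omega⟩
    have h3 : E j (.inr ⟨l, by omega⟩) < E j ((E j).symm t) := by
      rw [Equiv.apply_symm_apply]; show (_ : ℕ) < _ + 1; omega
    have h4 : E j ((E j).symm t) < E j (.inr ⟨l + 1, hl⟩) := by
      rw [Equiv.apply_symm_apply]; show _ + 1 < (_ : ℕ); omega
    rw [hE] at h3 h4
    simp only [pos] at h3 h4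
    omega
  · rintro F ⟨⟨hF1, hF2⟩, hF3, hF4⟩
    by_contra hlt
    have hFfin : F.Finite := Set.toFinite F
    choose blk hblk hblk' using fun x => (hF2 x)
    have hpig : ∃ B ∈ hFfin.toFinset, 2 <
        (Finset.univ.filter fun l : Fin (2 * k + 1) => blk (.inr l) = B).card := by
      apply Finset.exists_lt_card_fiber_of_mul_lt_card_of_maps_to
      · intro l _
        simpa using (hblk (.inr l)).1
      · rw [← Set.ncard_eq_toFinset_card F hFfin, Finset.card_univ, Fintype.card_fin]
        omega
    obtain ⟨B, hB, hcard⟩ := hpig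
    have hB : B ∈ F := by simpa using hB
    obtain ⟨a, ha, b, hb, c, hc, hab, hbc⟩ := sorted3 _ hcard
    have mem : ∀ l, l ∈ (Finset.univ.filter fun l : Fin (2 * k + 1) => blk (.inr l) = B) →
        (Sum.inr l : (Fin (k + 1) ⊕ Fin (2 * k + 1))) ∈ B := by
      intro l hl
      have h := (hblk (.inr l)).2
      rw [(Finset.mem_filter.1 hl).2] at h
      exact h
    have ha := mem a ha
    have hb := mem b hb
    have hc := mem c hc
    have claim1 : ∀ i : Fin (k + 1), (Sum.inl i : (Fin (k + 1) ⊕ Fin (2 * k + 1))) ∉ B := by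
      intro i hi
      exact no_restEq hN hN (E i.castSucc) (E i.succ) B (.inr a) (.inr b) (.inr c) (.inl i)
        ha hb hc hi (chain _ _ _ hab) (chain _ _ _ hbc) (right _ _ _ (by simp))
        (chain _ _ _ hab) (chain _ _ _ hbc) (left _ _ _ (by simp))
        (hF3 B hB _ ⟨_, rfl⟩ _ ⟨_, rfl⟩)
    have claim2 : ∀ i i' : Fin (k + 1), i < i' → blk (.inl i) ≠ blk (.inl i') := by
      intro i i' hii h
      have h1 := hblk (.inl i)
      have h2 := hblk (.inl i')
      rw [← h] at h2
      have hne : blk (.inl i) ≠ B := by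
        intro h'
        rw [h'] at h1
        exact claim1 i h1.2
      have hd := hF4 _ h1.1 _ hB hne (cat hN (E i.succ)) ⟨_, rfl⟩
      have l1 := left i.succ i b (by simp)
      have l2 := right i.succ i' b (by simpa using hii)
      have hii' : (i : ℕ) < i' := hii
      let w : CV (Nat.card (Fin (k + 1) ⊕ Fin (2 * k + 1))) := CV.sp (E i.succ (.inr b)) (Fin.is_lt _)
      have w1 : w ∈ (cat hN (E i.succ)).spanSet (blk (.inl i)) :=
        (span_iff hN _ _ w).2 (Or.inr ⟨rfl, .inl i, h1.2, .inl i', h2.2, l1.trans l2, l1.le, l2.le⟩)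
      have w2 : w ∈ (cat hN (E i.succ)).spanSet B :=
        (span_iff hN _ _ w).2 (Or.inr ⟨rfl, .inr a, ha, .inr b, hb, chain _ _ _ hab,
          (chain _ _ _ hab).le, le_rfl⟩)
      exact Set.disjoint_left.1 hd w1 w2
    have inj : Function.Injective fun i : Fin (k + 1) => blk (.inl i) := by
      intro i i' h
      rcases lt_trichotomy i i' with h1 | h1 | h1
      · exact absurd h (claim2 _ _ h1)
      · exact h1
      · exact absurd h.symm (claim2 _ _ h1)
    have hsub : (Set.range fun i : Fin (k + 1) => blk (.inl i)) ⊆ F := by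
      rintro _ ⟨i, rfl⟩; exact (hblk _).1
    have := Set.ncard_le_ncard hsub hFfin
    rw [Set.ncard_range_of_injective inj, Nat.card_eq_fintype_card, Fintype.card_fin] at this
    omega
  · rintro XC hXC
    have hinl : ∀ i : Fin (k + 1), (Sum.inl i : (Fin (k + 1) ⊕ Fin (2 * k + 1))) ∈ XC := by
      intro i; rw [hXC]; simp
    have hinr : ∀ l : Fin (2 * k + 1), (Sum.inr l : (Fin (k + 1) ⊕ Fin (2 * k + 1))) ∈ XC ↔ (l : ℕ) < k - 1 := by
      intro l; rw [hXC]
      constructor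
      · intro h
        by_contra h'
        exact h ⟨l, by omega, rfl⟩
      · rintro h ⟨i, hi, hil⟩
        have : i = l := Sum.inr_injective hil
        subst this
        omega
    have hinj : ∀ j : Fin (k + 2), Function.Injective fun z : XC => pos k j z.1 :=
      fun j => (pos_inj k j).comp Subtype.val_injective
    choose E' hE' using fun j : Fin (k + 2) => rank _ (hinj j)
    have hN' : 2 ≤ Nat.card XC := by
      have : Function.Injective fun i : Fin (k + 1) => (⟨.inl i, hinl i⟩ : XC) := by
        intro i i' h; simpa using h
      have h2 : Nat.card (Fin (k + 1)) ≤ Nat.card ↥XC := Nat.card_le_card_of_injective _ this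
      rw [Nat.card_eq_fintype_card, Fintype.card_fin] at h2
      exact le_trans (by omega) h2
    have hrest : ∀ j, UTree.IsRestrictionOf (cat hN (E j)) XC (cat hN' (E' j)) := by
      intro j
      obtain ⟨φ, h1, h2, h3, h4⟩ := key hN (E j) XC hN' (fun i => ((E' j).symm i).1) (by
        intro i i' h
        show E j _ < E j _
        rw [hE, ← hE' j]
        rw [(E' j).apply_symm_apply i, (E' j).apply_symm_apply i']
        exact h) (by
        ext x
        constructor
        · rintro ⟨i, rfl⟩; exact ((E' j).symm i).2
        · intro hx; exact ⟨E' j ⟨x, hx⟩, congrArg Subtype.val ((E' j).symm_apply_apply ⟨x, hx⟩)⟩)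
      refine ⟨φ, h1, ?_, h3, h4⟩
      intro x
      have := h2 (E' j x)
      simp only [Equiv.symm_apply_apply] at this
      exact this
    refine ⟨Set.range fun j => cat hN' (E' j), ⟨?_, ?_⟩, ?_⟩
    · rintro _ ⟨j, rfl⟩; exact ⟨_, ⟨j, rfl⟩, hrest j⟩
    · rintro _ ⟨j, rfl⟩; exact ⟨_, ⟨j, rfl⟩, hrest j⟩
    let yb : Fin (k + 1) → XC := fun i => ⟨.inl i, hinl i⟩
    let xb : Fin (k - 1) → XC := fun l =>
      ⟨.inr ⟨l, by have := l.2; omega⟩, (hinr _).2 l.2⟩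
    have hcases : ∀ z : XC, (∃ i, z = yb i) ∨ ∃ l, z = xb l := by
      rintro ⟨i | l, hz⟩
      · exact Or.inl ⟨i, rfl⟩
      · exact Or.inr ⟨⟨l, (hinr l).1 hz⟩, rfl⟩
    have hxy : ∀ l, xb l ∉ Set.range yb := by
      rintro l ⟨i, h⟩
      simp [xb, yb] at h
    have hymono : ∀ j, StrictMono fun i => E' j (yb i) := by
      intro j i i' h
      have h' : (i : ℕ) < i' := h
      show E' j _ < E' j _
      rw [hE']
      simp only [yb, pos]
      split_ifs <;> omega
    refine ⟨insert (Set.range yb) (Set.range fun l => ({xb l} : Set XC)), ⟨⟨?_, ?_⟩, ?_, ?_⟩, ?_⟩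
    · rintro B (rfl | ⟨l, rfl⟩)
      · exact ⟨yb 0, 0, rfl⟩
      · exact ⟨xb l, rfl⟩
    · intro z
      rcases hcases z with ⟨i, rfl⟩ | ⟨l, rfl⟩
      · refine ⟨Set.range yb, ⟨Or.inl rfl, ⟨i, rfl⟩⟩, ?_⟩
        rintro B ⟨rfl | ⟨l, rfl⟩, h⟩
        · rfl
        · exact absurd ⟨i, h⟩ (hxy l)
      · refine ⟨{xb l}, ⟨Or.inr ⟨l, rfl⟩, rfl⟩, ?_⟩
        rintro B ⟨rfl | ⟨l', rfl⟩, h⟩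
        · exact absurd h (hxy l)
        · have h : xb l = xb l' := h
          simp only [h]
    · rintro B (rfl | ⟨l, rfl⟩) _ ⟨j, rfl⟩ _ ⟨j', rfl⟩
      · exact restEq_of_mono hN' hN' (show 2 ≤ k + 1 by omega) _ _ _ yb (hymono j) (hymono j') rfl
      · exact restEq_singleton hN' hN' _ _ _
    · have hsing : ∀ (z : XC) (B : Set XC) (j : Fin (k + 2)), z ∉ B →
          Disjoint ((cat hN' (E' j)).spanSet {z}) ((cat hN' (E' j)).spanSet B) := by
        intro z B j hz
        rw [span_singleton, Set.disjoint_singleton_left]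
        exact lb_not_span hN' _ B z hz
      rintro B (rfl | ⟨l, rfl⟩) B' (rfl | ⟨l', rfl⟩) hne _ ⟨j, rfl⟩
      · exact absurd rfl hne
      · exact (hsing _ _ _ (hxy l')).symm
      · exact hsing _ _ _ (hxy l)
      · apply hsing
        intro h
        have h : xb l = xb l' := h
        exact hne (by simp only [h])
    · refine (Set.ncard_insert_le _ _).trans ?_
      have h1 : (Set.range fun l => ({xb l} : Set XC)).ncard ≤ k - 1 := by
        rw [← Set.image_univ]
        refine (Set.ncard_image_le (Set.toFinite _)).trans ?_
        rw [Set.ncard_univ, Nat.card_eq_fintype_card, Fintype.card_fin]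
      omega
end

section
/- For every k ≥ 4 there exist a finite set X, a set 𝒯 of t = k+2 rooted binary phylogenetic trees on X, and a common m-chain C' = (x_1,…,x_m) of 𝒯 with m = 2k+1, such that every rooted agreement forest for 𝒯 has size at least k+1, while the set of trees { T|(X ∖ {x_k,…,x_m}) : T ∈ 𝒯 } obtained by truncating C' to length k−1 has a rooted agreement forest of size at most k. (Hence in the rooted setting truncating common chains to length k−1 instead of k is not safe for parameter k.) -/
/-- A rooted binary phylogenetic tree on taxon set `X`: a finite directed tree with all
edges directed away from the root, whose root has in-degree 0 (and out-degree 2 unless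
it is itself the unique leaf), whose leaves (out-degree 0) are bijectively labelled by
`X`, and whose remaining vertices have in-degree 1 and out-degree 2. -/
structure RTree (X : Type) : Type 1 where
  V : Type
  finV : Finite V
  E : V → V → Prop
  root : V
  label : X → V
  label_inj : Function.Injective label
  reach_root : ∀ v : V, Relation.ReflTransGen E root v
  not_into_root : ∀ u : V, ¬ E u root
  leaf_iff : ∀ v : V, {w : V | E v w} = ∅ ↔ v ∈ Set.range label
  out_two : ∀ v : V, v ∉ Set.range label → {w : V | E v w}.ncard = 2
  in_one : ∀ v : V, v ≠ root → {u : V | E u v}.ncard = 1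

namespace RTree

variable {X : Type}

/-- `u` is an ancestor of (or equal to) `v`. -/
def anc (T : RTree X) (u v : T.V) : Prop := Relation.ReflTransGen T.E u v

/-- Vertex set of the minimal subtree `T[B]` of `T` spanning the leaves labelled by `B`:
the vertices that are ancestors of some leaf in `B` and descendants of every common
ancestor of all leaves in `B`. -/
def spanSet (T : RTree X) (B : Set X) : Set T.V :=
  {v | (∃ x ∈ B, T.anc v (T.label x)) ∧
    ∀ w : T.V, (∀ x ∈ B, T.anc w (T.label x)) → T.anc w v}

/-- `deg^T(B)`: the number of edges of `T` with exactly one endpoint in `T[B]`. -/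
noncomputable def blockDeg (T : RTree X) (B : Set X) : ℕ :=
  {p : T.V × T.V | T.E p.1 p.2 ∧
    Xor' (p.1 ∈ T.spanSet B) (p.2 ∈ T.spanSet B)}.ncard

/-- The vertices of `T[B]` surviving the suppression of in-degree-1 out-degree-1
vertices: the leaves labelled by `B` together with the branch points of `T[B]`. -/
def keepSet (T : RTree X) (B : Set X) : Set T.V :=
  {v | v ∈ T.spanSet B ∧
    (v ∈ T.label '' B ∨ 2 ≤ ({w : T.V | T.E v w} ∩ T.spanSet B).ncard)}

/-- Adjacency in the suppressed tree `T|B`: `v` is reachable from `u` by a directed path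
inside `T[B]` containing no other surviving vertex internally. -/
def restAdj (T : RTree X) (B : Set X) (u v : T.V) : Prop :=
  u ∈ T.keepSet B ∧ v ∈ T.keepSet B ∧ u ≠ v ∧
    Relation.ReflTransGen
      (fun a b => T.E a b ∧ b ∈ T.spanSet B ∧ (b = v ∨ b ∉ T.keepSet B)) u v

/-- `T|B = T'|B`: a leaf-label-preserving isomorphism between the suppressed trees
respecting edge directions. -/
def restEq (T T' : RTree X) (B : Set X) : Prop :=
  ∃ φ : T.V → T'.V, Set.BijOn φ (T.keepSet B) (T'.keepSet B) ∧
    (∀ x ∈ B, φ (T.label x) = T'.label x) ∧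
    ∀ u v : T.V, u ∈ T.keepSet B → v ∈ T.keepSet B →
      (T.restAdj B u v ↔ T'.restAdj B (φ u) (φ v))

/-- `F` is a partition of `X` into nonempty blocks. -/
def IsForestPartition (F : Set (Set X)) : Prop :=
  (∀ B ∈ F, B.Nonempty) ∧ ∀ x : X, ∃! B, B ∈ F ∧ x ∈ B

/-- A rooted agreement forest for `𝒯`: a partition of `X` whose blocks have a common
topology in all trees and induce pairwise vertex-disjoint subtrees in each tree. -/
def IsAgreementForest (𝒯 : Set (RTree X)) (F : Set (Set X)) : Prop :=
  IsForestPartition F ∧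
  (∀ B ∈ F, ∀ T ∈ 𝒯, ∀ T' ∈ 𝒯, restEq T T' B) ∧
  ∀ B ∈ F, ∀ B' ∈ F, B ≠ B' → ∀ T ∈ 𝒯, Disjoint (T.spanSet B) (T.spanSet B')

/-- `(x 0, …, x (m-1))` is a chain in the rooted tree `T`, with `x 0` closest to the
root: the parent of each `x i` is equal to, or the parent of, the parent of `x (i+1)`. -/
def IsChainIn (T : RTree X) {m : ℕ} (x : Fin m → X) : Prop :=
  ∀ (i : ℕ) (h1 : i + 1 < m), ∀ p q : T.V,
    T.E p (T.label (x ⟨i, Nat.lt_of_succ_lt h1⟩)) →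
    T.E q (T.label (x ⟨i + 1, h1⟩)) → p = q ∨ T.E p q

/-- A common `m`-chain of `𝒯`: a sequence of `m ≥ 2` distinct taxa that is a chain in
every tree of `𝒯`. -/
def IsCommonChain (𝒯 : Set (RTree X)) {m : ℕ} (x : Fin m → X) : Prop :=
  2 ≤ m ∧ Function.Injective x ∧ ∀ T ∈ 𝒯, T.IsChainIn x

/-- `T[S]` is pendant in `T`: there is an edge `(u,v)` such that the leaves below `v`
are exactly those labelled by `S`. -/
def IsPendant (T : RTree X) (S : Set X) : Prop :=
  ∃ u v : T.V, T.E u v ∧ ∀ x : X, (T.anc v (T.label x) ↔ x ∈ S)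

/-- A label-preserving isomorphism between `T[S]` and `T'[S]` respecting directions. -/
def pendantIso (T T' : RTree X) (S : Set X) : Prop :=
  ∃ φ : T.V → T'.V, Set.BijOn φ (T.spanSet S) (T'.spanSet S) ∧
    (∀ x ∈ S, φ (T.label x) = T'.label x) ∧
    ∀ u v : T.V, u ∈ T.spanSet S → v ∈ T.spanSet S →
      (T.E u v ↔ T'.E (φ u) (φ v))

/-- `S` induces a common pendant subtree of `𝒯`. -/
def InducesCommonPendant (𝒯 : Set (RTree X)) (S : Set X) : Prop :=
  S.Nonempty ∧ (∀ T ∈ 𝒯, IsPendant T S) ∧ ∀ T ∈ 𝒯, ∀ T' ∈ 𝒯, pendantIso T T' S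

/-- `T'` is (isomorphic to) the restriction `T|X'` of `T` to the taxa in `X'`. -/
def IsRestrictionOf (T : RTree X) (X' : Set X) (T' : RTree X') : Prop :=
  ∃ φ : T'.V → T.V, Function.Injective φ ∧
    (∀ x : X', φ (T'.label x) = T.label x.val) ∧
    Set.range φ = T.keepSet X' ∧
    ∀ u v : T'.V, T'.E u v ↔ T.restAdj X' (φ u) (φ v)

/-- `𝒯' = { T|X' : T ∈ 𝒯 }` up to label-preserving isomorphism. -/
def IsRestrictionFamily (𝒯 : Set (RTree X)) (X' : Set X) (𝒯' : Set (RTree X')) : Prop :=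
  (∀ T' ∈ 𝒯', ∃ T ∈ 𝒯, IsRestrictionOf T X' T') ∧
  ∀ T ∈ 𝒯, ∃ T' ∈ 𝒯', IsRestrictionOf T X' T'

/-- The subtree reduction rule is applicable: some `S` with `|S| ≥ 2` induces a common
pendant subtree. -/
def SubtreeRuleApplicable (𝒯 : Set (RTree X)) : Prop :=
  ∃ S : Set X, 2 ≤ S.ncard ∧ InducesCommonPendant 𝒯 S

/-- The chain reduction rule (with truncation length `r`) is applicable: `𝒯` has a
common `m`-chain with `m > r`. -/
def ChainRuleApplicable (𝒯 : Set (RTree X)) (r : ℕ) : Prop :=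
  ∃ (m : ℕ) (x : Fin m → X), r < m ∧ IsCommonChain 𝒯 x

end RTree

namespace RTree

section General
variable {X : Type}

lemma anc_refl (T : RTree X) (u : T.V) : T.anc u u := Relation.ReflTransGen.refl

lemma anc_trans (T : RTree X) {u v w : T.V} (h : T.anc u v) (h' : T.anc v w) : T.anc u w :=
  Relation.ReflTransGen.trans h h'

lemma parent_unique (T : RTree X) {u u' v : T.V} (h : T.E u v) (h' : T.E u' v) : u = u' := by
  have hv : v ≠ T.root := by
    rintro rfl
    exact T.not_into_root _ h
  obtain ⟨w, hw⟩ := Set.ncard_eq_one.1 (T.in_one v hv)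
  have h1 : u ∈ ({w} : Set T.V) := hw ▸ h
  have h2 : u' ∈ ({w} : Set T.V) := hw ▸ h'
  exact h1.trans h2.symm

lemma acyclic (T : RTree X) (v : T.V) : ¬ Relation.TransGen T.E v v := by
  have h := T.reach_root v
  induction h with
  | refl =>
    intro h
    obtain ⟨w, _, hw⟩ := Relation.TransGen.tail'_iff.1 h
    exact T.not_into_root _ hw
  | tail _ huv ih =>
    intro h
    obtain ⟨w, hw, hwv⟩ := Relation.TransGen.tail'_iff.1 h
    have := T.parent_unique huv hwv
    subst this
    exact ih (Relation.TransGen.head' huv hw)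

lemma anc_antisymm (T : RTree X) {u v : T.V} (h : T.anc u v) (h' : T.anc v u) : u = v := by
  rcases Relation.reflTransGen_iff_eq_or_transGen.1 h with h1 | h1
  · exact h1.symm
  · exact absurd (Relation.TransGen.trans_left h1 h') (T.acyclic u)

lemma ne_of_E (T : RTree X) {u v : T.V} (h : T.E u v) : u ≠ v := by
  rintro rfl
  exact T.acyclic u (Relation.TransGen.single h)

lemma label_anc (T : RTree X) {x : X} {v : T.V} (h : T.anc (T.label x) v) : v = T.label x := by
  rcases Relation.ReflTransGen.cases_head h with h | ⟨w, hw, _⟩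
  · exact h.symm
  · have := (T.leaf_iff (T.label x)).2 ⟨x, rfl⟩
    have hw' : w ∈ ({w : T.V | T.E (T.label x) w}) := hw
    rw [this] at hw'
    exact hw'.elim

lemma label_mem_span (T : RTree X) {x : X} {B : Set X} :
    T.label x ∈ T.spanSet B ↔ x ∈ B := by
  constructor
  · rintro ⟨⟨y, hy, hxy⟩, _⟩
    have := T.label_inj (T.label_anc hxy)
    exact this ▸ hy
  · intro h
    exact ⟨⟨x, h, T.anc_refl _⟩, fun w hw => hw x h⟩

/-- Two ancestors of the same vertex are comparable; path version. -/
lemma anc_total (T : RTree X) {u w v : T.V} (h : T.anc u v) (h' : T.anc w v) :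
    T.anc u w ∨ T.anc w u := by
  revert w
  induction h with
  | refl => intro w h'; exact Or.inr h'
  | tail hub hbc ih =>
    intro w h'
    rcases Relation.ReflTransGen.cases_tail h' with h1 | ⟨d, hd, hdc⟩
    · subst h1
      exact Or.inl (Relation.ReflTransGen.tail hub hbc)
    · have := T.parent_unique hbc hdc
      subst this
      exact ih hd

lemma E_iff_cov (T : RTree X) (u v : T.V) :
    T.E u v ↔ T.anc u v ∧ u ≠ v ∧ ∀ w, T.anc u w → T.anc w v → w = u ∨ w = v := by
  constructor
  · intro h
    refine ⟨Relation.ReflTransGen.single h, T.ne_of_E h, fun w h1 h2 => ?_⟩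
    rcases Relation.ReflTransGen.cases_tail h2 with h3 | ⟨d, hd, hdv⟩
    · exact Or.inr h3.symm
    · have := T.parent_unique h hdv
      subst this
      exact Or.inl (T.anc_antisymm hd h1)
  · rintro ⟨h1, h2, h3⟩
    rcases Relation.ReflTransGen.cases_head h1 with h | ⟨w, hw, hwv⟩
    · exact absurd h h2
    · rcases h3 w (Relation.ReflTransGen.single hw) hwv with h | h
      · exact absurd h.symm (T.ne_of_E hw)
      · exact h ▸ hw

lemma span_convex (T : RTree X) {B : Set X} {u v w : T.V} (hu : u ∈ T.spanSet B)
    (hv : v ∈ T.spanSet B) (h1 : T.anc u w) (h2 : T.anc w v) : w ∈ T.spanSet B := by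
  obtain ⟨x, hx, hvx⟩ := hv.1
  exact ⟨⟨x, hx, T.anc_trans h2 hvx⟩, fun d hd => T.anc_trans (hu.2 d hd) h1⟩

lemma restAdj_iff (T : RTree X) (B : Set X) (u v : T.V) :
    T.restAdj B u v ↔ u ∈ T.keepSet B ∧ v ∈ T.keepSet B ∧ T.anc u v ∧ u ≠ v ∧
      ∀ w ∈ T.keepSet B, T.anc u w → T.anc w v → w = u ∨ w = v := by
  constructor
  · rintro ⟨hu, hv, hne, hp⟩
    refine ⟨hu, hv, Relation.ReflTransGen.mono (fun _ _ h => h.1) _ _ hp, hne, ?_⟩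
    have key : ∀ c, Relation.ReflTransGen
        (fun a b => T.E a b ∧ b ∈ T.spanSet B ∧ (b = v ∨ b ∉ T.keepSet B)) u c →
        ∀ w ∈ T.keepSet B, T.anc u w → T.anc w c → w = u ∨ w = v := by
      intro c hc
      induction hc with
      | refl => intro w _ h1 h2; exact Or.inl (T.anc_antisymm h2 h1)
      | tail _ hbc ih =>
        intro w hw h1 h2
        rcases Relation.ReflTransGen.cases_tail h2 with h3 | ⟨d, hd, hdv⟩
        · rcases hbc.2.2 with h4 | h4
          · exact Or.inr (h3.symm.trans h4)
          · exact absurd (h3.symm ▸ hw) h4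
        · have := T.parent_unique hbc.1 hdv
          subst this
          exact ih w hw h1 hd
    exact key v hp
  · rintro ⟨hu, hv, h, hne, hc⟩
    refine ⟨hu, hv, hne, ?_⟩
    have key : ∀ c, T.anc u c → T.anc c v → Relation.ReflTransGen
        (fun a b => T.E a b ∧ b ∈ T.spanSet B ∧ (b = v ∨ b ∉ T.keepSet B)) u c := by
      intro c hc1
      induction hc1 with
      | refl => intro _; exact Relation.ReflTransGen.refl
      | @tail b c hub hbc ih =>
        intro hcv
        have huc : T.anc u c := Relation.ReflTransGen.tail hub hbc
        refine Relation.ReflTransGen.tail (ih (Relation.ReflTransGen.head hbc hcv))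
          ⟨hbc, T.span_convex hu.1 hv.1 huc hcv, ?_⟩
        by_contra hcon
        push Not at hcon
        rcases hc c hcon.2 huc hcv with h5 | h5
        · subst h5
          exact T.acyclic c (Relation.TransGen.tail' hub hbc)
        · exact hcon.1 h5
    exact key v h (T.anc_refl v)

lemma anc_iff_restPath (T : RTree X) (B : Set X) {u v : T.V} (hu : u ∈ T.keepSet B)
    (hv : v ∈ T.keepSet B) : T.anc u v ↔ Relation.ReflTransGen (T.restAdj B) u v := by
  have : Finite T.V := T.finV
  constructor
  · intro h
    obtain ⟨n, hn⟩ : ∃ n, n = {w | w ∈ T.keepSet B ∧ T.anc u w ∧ T.anc w v}.ncard := ⟨_, rfl⟩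
    induction n using Nat.strong_induction_on generalizing u v with
    | _ n ih =>
      by_cases huv : u = v
      · subst huv; exact Relation.ReflTransGen.refl
      by_cases hc : ∀ w ∈ T.keepSet B, T.anc u w → T.anc w v → w = u ∨ w = v
      · exact Relation.ReflTransGen.single ((T.restAdj_iff B u v).2 ⟨hu, hv, h, huv, hc⟩)
      · push Not at hc
        obtain ⟨w, hw, huw, hwv, hwu, hwv'⟩ := hc
        subst hn
        refine Relation.ReflTransGen.trans (ih _ ?_ hu hw huw rfl) (ih _ ?_ hw hv hwv rfl)
        · apply Set.ncard_lt_ncard _ (Set.toFinite _)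
          refine ⟨fun d hd => ⟨hd.1, hd.2.1, T.anc_trans hd.2.2 hwv⟩, fun hs => ?_⟩
          have := hs (show v ∈ _ from ⟨hv, h, T.anc_refl v⟩)
          exact hwv' (T.anc_antisymm hwv this.2.2)
        · apply Set.ncard_lt_ncard _ (Set.toFinite _)
          refine ⟨fun d hd => ⟨hd.1, T.anc_trans huw hd.2.1, hd.2.2⟩, fun hs => ?_⟩
          have := hs (show u ∈ _ from ⟨hu, T.anc_refl u, h⟩)
          exact hwu (T.anc_antisymm this.2.1 huw)
  · intro h
    clear hu hv
    induction h with
    | refl => exact T.anc_refl _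
    | tail _ h ih => exact T.anc_trans ih ((T.restAdj_iff B _ _).1 h).2.2.1

lemma iso_anc {T T' : RTree X} {B : Set X} {φ : T.V → T'.V}
    (hb : Set.BijOn φ (T.keepSet B) (T'.keepSet B))
    (hadj : ∀ u v : T.V, u ∈ T.keepSet B → v ∈ T.keepSet B →
      (T.restAdj B u v ↔ T'.restAdj B (φ u) (φ v))) {u v : T.V}
    (hu : u ∈ T.keepSet B) (hv : v ∈ T.keepSet B) :
    T.anc u v ↔ T'.anc (φ u) (φ v) := by
  rw [T.anc_iff_restPath B hu hv, T'.anc_iff_restPath B (hb.mapsTo hu) (hb.mapsTo hv)]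
  constructor
  · intro h
    clear hv
    induction h with
    | refl => exact Relation.ReflTransGen.refl
    | tail _ hab ih => exact Relation.ReflTransGen.tail ih ((hadj _ _ hab.1 hab.2.1).1 hab)
  · intro h
    have key : ∀ y, Relation.ReflTransGen (T'.restAdj B) (φ u) y → ∀ v ∈ T.keepSet B,
        φ v = y → Relation.ReflTransGen (T.restAdj B) u v := by
      intro y hy
      induction hy with
      | refl =>
        intro v hv h
        rw [hb.injOn hv hu h]
      | tail _ hbc ih =>
        intro v hv h
        obtain ⟨b0, hb0, rfl⟩ := hb.surjOn hbc.1
        subst h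
        exact Relation.ReflTransGen.tail (ih b0 hb0 rfl) ((hadj b0 v hb0 hv).2 hbc)
    exact key _ h v hv rfl

lemma label_mem_keep (T : RTree X) {x : X} {B : Set X} (h : x ∈ B) :
    T.label x ∈ T.keepSet B := ⟨T.label_mem_span.2 h, Or.inl ⟨x, h, rfl⟩⟩

lemma mem_keep_of_branch (T : RTree X) {B : Set X} {p w w' : T.V} (hp : p ∈ T.spanSet B)
    (hw : T.E p w) (hw' : T.E p w') (hne : w ≠ w') {x x' : X} (hx : x ∈ B) (hx' : x' ∈ B)
    (hwx : T.anc w (T.label x)) (hwx' : T.anc w' (T.label x')) : p ∈ T.keepSet B := by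
  have : Finite T.V := T.finV
  refine ⟨hp, Or.inr ?_⟩
  have h1 : w ∈ T.spanSet B :=
    ⟨⟨x, hx, hwx⟩, fun d hd => T.anc_trans (hp.2 d hd) (Relation.ReflTransGen.single hw)⟩
  have h2 : w' ∈ T.spanSet B :=
    ⟨⟨x', hx', hwx'⟩, fun d hd => T.anc_trans (hp.2 d hd) (Relation.ReflTransGen.single hw')⟩
  rw [← Set.ncard_pair hne]
  apply Set.ncard_le_ncard _ (Set.toFinite _)
  rintro d (rfl | rfl)
  · exact ⟨hw, h1⟩
  · exact ⟨hw', h2⟩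

lemma span_singleton (T : RTree X) (x : X) : T.spanSet {x} = {T.label x} := by
  ext v
  constructor
  · rintro ⟨⟨y, rfl, hy⟩, h2⟩
    refine T.anc_antisymm hy (h2 _ ?_)
    rintro y' rfl
    exact T.anc_refl _
  · rintro rfl
    exact T.label_mem_span.2 rfl

lemma keep_singleton (T : RTree X) (x : X) : T.keepSet {x} = {T.label x} := by
  ext v
  constructor
  · intro h
    have := h.1
    rwa [T.span_singleton] at this
  · rintro rfl
    exact T.label_mem_keep rfl

lemma restEq_singleton (T T' : RTree X) (x : X) : restEq T T' {x} := by
  refine ⟨fun _ => T'.label x, ?_, ?_, ?_⟩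
  · rw [keep_singleton, keep_singleton]
    simp
  · rintro y rfl; rfl
  · intro u v hu hv
    rw [keep_singleton] at hu hv
    constructor
    · intro h; exact absurd (hu.trans hv.symm) h.2.2.1
    · intro h; exact absurd rfl h.2.2.1

end General

/-- Data of a caterpillar: taxa ordered by `pos`, with `z` at the very bottom. -/
structure CatData (X : Type) where
  z : X
  pos : X → ℕ
  inj : Function.Injective pos
  le_z : ∀ x, pos x ≤ pos z
  ne : ∃ a, a ≠ z

namespace CatData

variable {X : Type}

/-- Edges of the caterpillar: vertex `inr a` is the parent of leaf `inl a`. -/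
def E (D : CatData X) : X ⊕ {a : X // a ≠ D.z} → X ⊕ {a : X // a ≠ D.z} → Prop
  | Sum.inr a, Sum.inl b => a.1 = b ∨ (b = D.z ∧ ∀ c, c ≠ D.z → D.pos c ≤ D.pos a)
  | Sum.inr a, Sum.inr b => D.pos a < D.pos b ∧ ∀ c, c ≠ D.z → D.pos c ≤ D.pos a ∨ D.pos b ≤ D.pos c
  | Sum.inl _, _ => False

/-- The ancestor relation of the caterpillar. -/
def A (D : CatData X) : X ⊕ {a : X // a ≠ D.z} → X ⊕ {a : X // a ≠ D.z} → Prop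
  | Sum.inr a, Sum.inl b => D.pos a ≤ D.pos b
  | Sum.inr a, Sum.inr b => D.pos a ≤ D.pos b
  | Sum.inl a, Sum.inl b => a = b
  | Sum.inl _, Sum.inr _ => False

variable [Finite X] (D : CatData X)

lemma exists_root : ∃ r : {a : X // a ≠ D.z}, ∀ c, c ≠ D.z → D.pos r ≤ D.pos c := by
  obtain ⟨a, ha⟩ := D.ne
  obtain ⟨r, hr, h⟩ := Set.exists_min_image {a : X | a ≠ D.z} D.pos (Set.toFinite _) ⟨a, ha⟩
  exact ⟨⟨r, hr⟩, h⟩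

lemma exists_last : ∃ r : {a : X // a ≠ D.z}, ∀ c, c ≠ D.z → D.pos c ≤ D.pos r := by
  obtain ⟨a, ha⟩ := D.ne
  obtain ⟨r, hr, h⟩ := Set.exists_max_image {a : X | a ≠ D.z} D.pos (Set.toFinite _) ⟨a, ha⟩
  exact ⟨⟨r, hr⟩, h⟩

lemma exists_next (a : X) (h : ∃ c, c ≠ D.z ∧ D.pos a < D.pos c) :
    ∃ b : {a : X // a ≠ D.z}, D.pos a < D.pos b ∧
      ∀ c, c ≠ D.z → D.pos c ≤ D.pos a ∨ D.pos b ≤ D.pos c := by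
  obtain ⟨r, hr, h⟩ := Set.exists_min_image {c : X | c ≠ D.z ∧ D.pos a < D.pos c} D.pos
    (Set.toFinite _) h
  refine ⟨⟨r, hr.1⟩, hr.2, fun c hc => ?_⟩
  by_cases h' : D.pos a < D.pos c
  · exact Or.inr (h c ⟨hc, h'⟩)
  · exact Or.inl (not_lt.1 h')

lemma exists_prev (a : X) (h : ∃ c, c ≠ D.z ∧ D.pos c < D.pos a) :
    ∃ b : {a : X // a ≠ D.z}, D.pos b < D.pos a ∧
      ∀ c, c ≠ D.z → D.pos c ≤ D.pos b ∨ D.pos a ≤ D.pos c := by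
  obtain ⟨r, hr, h⟩ := Set.exists_max_image {c : X | c ≠ D.z ∧ D.pos c < D.pos a} D.pos
    (Set.toFinite _) h
  refine ⟨⟨r, hr.1⟩, hr.2, fun c hc => ?_⟩
  by_cases h' : D.pos c < D.pos a
  · exact Or.inl (h c ⟨hc, h'⟩)
  · exact Or.inr (not_lt.1 h')

lemma A_of_E {u v} (h : D.E u v) : D.A u v := by
  rcases u with u | u <;> rcases v with v | v
  · exact h.elim
  · exact h.elim
  · rcases h with h | h
    · exact le_of_eq (congrArg D.pos h)
    · exact h.1 ▸ D.le_z _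
  · exact h.1.le

lemma A_trans {u v w} (h : D.A u v) (h' : D.A v w) : D.A u w := by
  rcases u with u | u <;> rcases v with v | v <;> rcases w with w | w <;>
    simp only [A] at * <;> first | omega | (subst h; exact h') | (subst h'; exact h)

lemma path_inr (a b : {a : X // a ≠ D.z}) (h : D.pos a ≤ D.pos b) :
    Relation.ReflTransGen D.E (Sum.inr a) (Sum.inr b) := by
  obtain ⟨n, hn⟩ : ∃ n, n = D.pos b - D.pos a := ⟨_, rfl⟩
  induction n using Nat.strong_induction_on generalizing a with
  | _ n ih =>
    rcases h.eq_or_lt with h | h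
    · have := D.inj h
      rw [Subtype.ext this]
    · obtain ⟨c, hc, hc'⟩ := D.exists_next a ⟨b, b.2, h⟩
      have hcb : D.pos c ≤ D.pos b := by
        rcases hc' b b.2 with h' | h'
        · omega
        · exact h'
      exact Relation.ReflTransGen.head (show D.E (Sum.inr a) (Sum.inr c) from ⟨hc, hc'⟩)
        (ih _ (by omega) c hcb rfl)

lemma reach_iff (u v) : Relation.ReflTransGen D.E u v ↔ D.A u v := by
  constructor
  · intro h
    induction h with
    | refl => rcases u with u | u <;> simp [A]
    | tail _ h ih => exact D.A_trans ih (D.A_of_E h)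
  · intro h
    rcases u with u | u <;> rcases v with v | v
    · have : u = v := h
      rw [this]
    · exact h.elim
    · by_cases hv : v = D.z
      · obtain ⟨l, hl⟩ := D.exists_last
        exact Relation.ReflTransGen.tail (D.path_inr u l (hl u u.2))
          (show D.E (Sum.inr l) (Sum.inl v) from Or.inr ⟨hv, hl⟩)
      · exact Relation.ReflTransGen.tail (D.path_inr u ⟨v, hv⟩ h)
          (show D.E (Sum.inr ⟨v, hv⟩) (Sum.inl v) from Or.inl rfl)
    · exact D.path_inr u v h

/-- The two children of an internal vertex. -/
lemma children (a : {a : X // a ≠ D.z}) :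
    ∃ w, w ≠ Sum.inl a.1 ∧ {w | D.E (Sum.inr a) w} = {Sum.inl a.1, w} := by
  by_cases h : ∃ c, c ≠ D.z ∧ D.pos a < D.pos c
  · obtain ⟨b, hb, hb'⟩ := D.exists_next a h
    refine ⟨Sum.inr b, by simp, ?_⟩
    ext w
    rcases w with w | w
    · simp only [Set.mem_ofPred_eq, E, Set.mem_insert_iff, Set.mem_singleton_iff, Sum.inl.injEq,
        reduceCtorEq, or_false]
      constructor
      · rintro (h | h)
        · exact h.symm
        · have := h.2 b b.2
          omega
      · intro h; exact Or.inl h.symm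
    · simp only [Set.mem_ofPred_eq, E, Set.mem_insert_iff, Set.mem_singleton_iff, Sum.inr.injEq,
        reduceCtorEq, false_or]
      constructor
      · rintro ⟨h1, h2⟩
        apply Subtype.ext
        apply D.inj
        have := h2 b b.2
        have := hb' w w.2
        omega
      · rintro rfl; exact ⟨hb, hb'⟩
  · push Not at h
    refine ⟨Sum.inl D.z, by simpa using a.2.symm, ?_⟩
    ext w
    rcases w with w | w
    · simp only [Set.mem_ofPred_eq, E, Set.mem_insert_iff, Set.mem_singleton_iff, Sum.inl.injEq]
      constructor
      · rintro (h | h)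
        · exact Or.inl h.symm
        · exact Or.inr h.1
      · rintro (h' | h')
        · exact Or.inl h'.symm
        · exact Or.inr ⟨h', h⟩
    · simp only [Set.mem_ofPred_eq, E, Set.mem_insert_iff, Set.mem_singleton_iff,
        reduceCtorEq, or_self, iff_false]
      rintro ⟨h1, _⟩
      have := h w w.2
      omega

/-- The caterpillar tree. -/
noncomputable def tree : RTree X where
  V := X ⊕ {a : X // a ≠ D.z}
  finV := inferInstance
  E := D.E
  root := Sum.inr D.exists_root.choose
  label := Sum.inl
  label_inj := Sum.inl_injective
  reach_root := by
    intro v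
    rw [reach_iff]
    have h := D.exists_root.choose_spec
    rcases v with v | v
    · by_cases hv : v = D.z
      · subst hv; exact D.le_z _
      · exact h v hv
    · exact h v v.2
  not_into_root := by
    have h := D.exists_root.choose_spec
    rintro (u | u) hu
    · exact hu
    · have := h u u.2
      have := hu.1
      omega
  leaf_iff := by
    rintro (v | v)
    · simp [E]
    · obtain ⟨w, _, hw⟩ := D.children v
      rw [hw]
      simp only [Set.mem_range, reduceCtorEq, exists_false, iff_false]
      exact (Set.insert_nonempty _ _).ne_empty
  out_two := by
    rintro (v | v) hv
    · simp at hv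
    · obtain ⟨w, hne, hw⟩ := D.children v
      rw [hw]
      exact Set.ncard_pair hne.symm
  in_one := by
    have h := D.exists_root.choose_spec
    intro v hv
    rw [Set.ncard_eq_one]
    rcases v with v | v
    · by_cases hz : v = D.z
      · subst hz
        obtain ⟨l, hl⟩ := D.exists_last
        refine ⟨Sum.inr l, ?_⟩
        ext u
        rcases u with u | u
        · simp [E]
        · simp only [Set.mem_ofPred_eq, E, Set.mem_singleton_iff, Sum.inr.injEq]
          constructor
          · rintro (h1 | h1)
            · exact absurd h1 u.2
            · exact Subtype.ext (D.inj (le_antisymm (hl u u.2) (h1.2 l l.2)))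
          · rintro rfl
            exact Or.inr ⟨trivial, hl⟩
      · refine ⟨Sum.inr ⟨v, hz⟩, ?_⟩
        ext u
        rcases u with u | u
        · simp [E]
        · simp only [Set.mem_ofPred_eq, E, Set.mem_singleton_iff, Sum.inr.injEq]
          constructor
          · rintro (h1 | h1)
            · exact Subtype.ext h1
            · exact absurd h1.1 hz
          · rintro rfl
            exact Or.inl rfl
    · have hlt : D.pos (D.exists_root.choose) < D.pos v := by
        refine lt_of_le_of_ne (h v v.2) (fun h' => hv ?_)
        rw [Subtype.ext (D.inj h')]
      obtain ⟨b, hb, hb'⟩ := D.exists_prev v ⟨_, D.exists_root.choose.2, hlt⟩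
      refine ⟨Sum.inr b, ?_⟩
      ext u
      rcases u with u | u
      · simp [E]
      · simp only [Set.mem_ofPred_eq, E, Set.mem_singleton_iff, Sum.inr.injEq]
        constructor
        · rintro ⟨h1, h2⟩
          apply Subtype.ext
          apply D.inj
          have := h2 b b.2
          have := hb' u u.2
          omega
        · rintro rfl
          exact ⟨hb, hb'⟩

/-- Leaf vertex. -/
def lf (x : X) : D.tree.V := (Sum.inl x : X ⊕ {a : X // a ≠ D.z})
/-- Internal vertex. -/
def nd (a : X) (h : a ≠ D.z) : D.tree.V := (Sum.inr ⟨a, h⟩ : X ⊕ {a : X // a ≠ D.z})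

lemma label_eq (x : X) : D.tree.label x = D.lf x := rfl

lemma vcases (v : D.tree.V) : (∃ x, v = D.lf x) ∨ ∃ a h, v = D.nd a h := by
  rcases (v : X ⊕ {a : X // a ≠ D.z}) with x | a
  · exact Or.inl ⟨x, rfl⟩
  · exact Or.inr ⟨a.1, a.2, rfl⟩

lemma anc_nd_lf (a b : X) (h) : D.tree.anc (D.nd a h) (D.lf b) ↔ D.pos a ≤ D.pos b :=
  D.reach_iff _ _
lemma anc_nd_nd (a b : X) (h h') : D.tree.anc (D.nd a h) (D.nd b h') ↔ D.pos a ≤ D.pos b :=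
  D.reach_iff _ _
lemma anc_lf_lf (a b : X) : D.tree.anc (D.lf a) (D.lf b) ↔ a = b :=
  D.reach_iff _ _
lemma anc_lf_nd (a b : X) (h') : D.tree.anc (D.lf a) (D.nd b h') ↔ False :=
  D.reach_iff _ _

/-- A vertex above two distinct leaves is internal. -/
lemma common_anc {w : D.tree.V} {x y : X} (hne : x ≠ y) (hx : D.tree.anc w (D.lf x))
    (hy : D.tree.anc w (D.lf y)) :
    ∃ a h, w = D.nd a h ∧ D.pos a ≤ D.pos x ∧ D.pos a ≤ D.pos y := by
  rcases D.vcases w with ⟨d, rfl⟩ | ⟨a, h, rfl⟩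
  · rw [anc_lf_lf] at hx hy
    exact absurd (hx.symm.trans hy) hne
  · exact ⟨a, h, rfl, (D.anc_nd_lf _ _ _).1 hx, (D.anc_nd_lf _ _ _).1 hy⟩

lemma nd_mem_span {B : Set X} {c x y : X} (hc : c ≠ D.z) (hx : x ∈ B) (hy : y ∈ B)
    (hxc : D.pos x ≤ D.pos c) (hcy : D.pos c ≤ D.pos y) (hxy : x ≠ y) :
    D.nd c hc ∈ D.tree.spanSet B := by
  refine ⟨⟨y, hy, (D.anc_nd_lf _ _ _).2 hcy⟩, fun w hw => ?_⟩
  obtain ⟨a, h, rfl, h1, h2⟩ := D.common_anc hxy (hw x hx) (hw y hy)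
  exact (D.anc_nd_nd _ _ _ _).2 (h1.trans hxc)

lemma nd_mem_keep {B : Set X} {x y : X} (hc : x ≠ D.z) (hx : x ∈ B) (hy : y ∈ B)
    (hxy : D.pos x < D.pos y) : D.nd x hc ∈ D.tree.keepSet B := by
  have hne : x ≠ y := by rintro rfl; omega
  have hanc := (D.anc_nd_lf x y hc).2 hxy.le
  rcases Relation.ReflTransGen.cases_head hanc with h | ⟨w, hw, hwy⟩
  · exact absurd h (by intro h; cases h)
  · refine D.tree.mem_keep_of_branch (D.nd_mem_span hc hx hy le_rfl hxy.le hne)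
      (w := D.lf x) (w' := w) (Or.inl rfl) hw ?_ hx hy (D.tree.anc_refl _) hwy
    rintro rfl
    exact hne ((D.anc_lf_lf _ _).1 hwy)

lemma lf_mem_keep {B : Set X} {x : X} : D.lf x ∈ D.tree.keepSet B ↔ x ∈ B :=
  ⟨fun h => D.tree.label_mem_span.1 h.1, fun h => D.tree.label_mem_keep h⟩

lemma nd_mem_keep_iff {B : Set X} (hz : D.z ∈ B) {a : X} (ha : a ≠ D.z) :
    D.nd a ha ∈ D.tree.keepSet B ↔ a ∈ B := by
  constructor
  · rintro ⟨_, h | h⟩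
    · obtain ⟨x, _, hx⟩ := h
      cases hx
    · by_contra haB
      obtain ⟨w, hne, hw⟩ := D.children ⟨a, ha⟩
      have hsub : {w | D.tree.E (D.nd a ha) w} ∩ D.tree.spanSet B ⊆ {(w : D.tree.V)} := by
        rintro v ⟨hv, hvs⟩
        have hv' : v ∈ ({Sum.inl a, w} : Set (X ⊕ {a : X // a ≠ D.z})) := hw ▸ hv
        rcases hv' with rfl | hv'
        · exact absurd (D.tree.label_mem_span.1 hvs) haB
        · exact hv'
      have := Set.ncard_le_ncard hsub (Set.finite_singleton _)
      have h1 := Set.ncard_singleton (α := D.tree.V) w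
      omega
  · intro h
    exact D.nd_mem_keep ha h hz (lt_of_le_of_ne (D.le_z a) (fun h => ha (D.inj h)))

/-- Restriction of caterpillar data to a subset containing `z`. -/
def restrict (S : Set X) (hz : D.z ∈ S) (hne : ∃ a ∈ S, a ≠ D.z) : CatData S where
  z := ⟨D.z, hz⟩
  pos := fun x => D.pos x.1
  inj := fun _ _ h => Subtype.ext (D.inj h)
  le_z := fun x => D.le_z x.1
  ne := by
    obtain ⟨a, ha, h⟩ := hne
    exact ⟨⟨a, ha⟩, fun h' => h (congrArg Subtype.val h')⟩

lemma isRestriction (S : Set X) (hz : D.z ∈ S) (hne : ∃ a ∈ S, a ≠ D.z) :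
    IsRestrictionOf D.tree S (D.restrict S hz hne).tree := by
  set D' := D.restrict S hz hne with hD'
  have hz' : ∀ a : S, a ≠ D'.z → a.1 ≠ D.z := fun a h h' => h (Subtype.ext h')
  let φ : D'.tree.V → D.tree.V := fun v =>
    Sum.elim (α := S) (β := {a : S // a ≠ D'.z}) (fun x => D.lf x.1)
      (fun a => D.nd a.1.1 (hz' a.1 a.2)) v
  have φlf : ∀ x, φ (D'.lf x) = D.lf x.1 := fun x => rfl
  have φnd : ∀ a h, φ (D'.nd a h) = D.nd a.1 (hz' a h) := fun a h => rfl
  have hinj : Function.Injective φ := by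
    intro u v huv
    rcases D'.vcases u with ⟨x, rfl⟩ | ⟨a, h, rfl⟩ <;>
      rcases D'.vcases v with ⟨y, rfl⟩ | ⟨b, h', rfl⟩
    · rw [φlf, φlf] at huv
      have : x.1 = y.1 := Sum.inl_injective huv
      rw [Subtype.ext this]
    · cases huv
    · cases huv
    · rw [φnd, φnd] at huv
      have : a.1 = b.1 := congrArg (fun t : {a : X // a ≠ D.z} => t.1)
        (Sum.inr_injective (β := {a : X // a ≠ D.z}) huv)
      have := Subtype.ext this
      subst this
      rfl
  have hrange : Set.range φ = D.tree.keepSet S := by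
    ext v
    constructor
    · rintro ⟨u, rfl⟩
      rcases D'.vcases u with ⟨x, rfl⟩ | ⟨a, h, rfl⟩
      · rw [φlf]; exact D.lf_mem_keep.2 x.2
      · rw [φnd]; exact (D.nd_mem_keep_iff hz _).2 a.2
    · intro hv
      rcases D.vcases v with ⟨x, rfl⟩ | ⟨a, h, rfl⟩
      · exact ⟨D'.lf ⟨x, D.lf_mem_keep.1 hv⟩, rfl⟩
      · exact ⟨D'.nd ⟨a, (D.nd_mem_keep_iff hz h).1 hv⟩
          (fun h' => h (congrArg Subtype.val h')), rfl⟩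
  have hanc : ∀ u v, D'.tree.anc u v ↔ D.tree.anc (φ u) (φ v) := by
    intro u v
    rcases D'.vcases u with ⟨x, rfl⟩ | ⟨a, h, rfl⟩ <;>
      rcases D'.vcases v with ⟨y, rfl⟩ | ⟨b, h', rfl⟩
    · rw [φlf, φlf, anc_lf_lf, anc_lf_lf, Subtype.ext_iff]
    · rw [φlf, φnd, anc_lf_nd, anc_lf_nd]
    · rw [φlf, φnd, anc_nd_lf, anc_nd_lf]; rfl
    · rw [φnd, φnd, anc_nd_nd, anc_nd_nd]; rfl
  refine ⟨φ, hinj, fun x => rfl, hrange, fun u v => ?_⟩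
  rw [E_iff_cov, restAdj_iff, ← hrange]
  simp only [Set.mem_range, exists_apply_eq_apply, true_and, forall_exists_index,
    forall_apply_eq_imp_iff, hanc, hinj.eq_iff, ne_eq]

end CatData

lemma cat_restEq {X : Type} [Finite X] (D D' : CatData X) (hzz : D.z = D'.z) (B : Set X)
    (hz : D.z ∈ B) (hord : ∀ x ∈ B, ∀ y ∈ B, D.pos x ≤ D.pos y ↔ D'.pos x ≤ D'.pos y) :
    restEq D.tree D'.tree B := by
  have hz1 : ∀ a, a ≠ D.z → a ≠ D'.z := fun a h => hzz ▸ h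
  have hz2 : ∀ a, a ≠ D'.z → a ≠ D.z := fun a h => hzz ▸ h
  have hz' : D'.z ∈ B := hzz ▸ hz
  let φ : D.tree.V → D'.tree.V := fun v =>
    Sum.elim (α := X) (β := {a : X // a ≠ D.z}) (fun x => D'.lf x)
      (fun a => D'.nd a.1 (hz1 a.1 a.2)) v
  have φlf : ∀ x, φ (D.lf x) = D'.lf x := fun x => rfl
  have φnd : ∀ a h, φ (D.nd a h) = D'.nd a (hz1 a h) := fun a h => rfl
  have hinj : Function.Injective φ := by
    intro u v huv
    rcases D.vcases u with ⟨x, rfl⟩ | ⟨a, h, rfl⟩ <;>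
      rcases D.vcases v with ⟨y, rfl⟩ | ⟨b, h', rfl⟩
    · rw [φlf, φlf] at huv
      have : x = y := Sum.inl_injective huv
      rw [this]
    · cases huv
    · cases huv
    · rw [φnd, φnd] at huv
      have : a = b := congrArg Subtype.val (Sum.inr_injective huv)
      subst this
      rfl
  have himg : φ '' (D.tree.keepSet B) = D'.tree.keepSet B := by
    ext v
    constructor
    · rintro ⟨u, hu, rfl⟩
      rcases D.vcases u with ⟨x, rfl⟩ | ⟨a, h, rfl⟩
      · exact D'.lf_mem_keep.2 (D.lf_mem_keep.1 hu)
      · exact (D'.nd_mem_keep_iff hz' _).2 ((D.nd_mem_keep_iff hz _).1 hu)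
    · intro hv
      rcases D'.vcases v with ⟨x, rfl⟩ | ⟨a, h, rfl⟩
      · exact ⟨D.lf x, D.lf_mem_keep.2 (D'.lf_mem_keep.1 hv), rfl⟩
      · exact ⟨D.nd a (hz2 a h), (D.nd_mem_keep_iff hz _).2 ((D'.nd_mem_keep_iff hz' h).1 hv), rfl⟩
  have hanc : ∀ u ∈ D.tree.keepSet B, ∀ v ∈ D.tree.keepSet B,
      (D.tree.anc u v ↔ D'.tree.anc (φ u) (φ v)) := by
    intro u hu v hv
    rcases D.vcases u with ⟨x, rfl⟩ | ⟨a, h, rfl⟩ <;>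
      rcases D.vcases v with ⟨y, rfl⟩ | ⟨b, h', rfl⟩
    · rw [φlf, φlf, CatData.anc_lf_lf, CatData.anc_lf_lf]
    · rw [φlf, φnd, CatData.anc_lf_nd, CatData.anc_lf_nd]
    · rw [φlf, φnd, CatData.anc_nd_lf, CatData.anc_nd_lf]
      exact hord _ ((D.nd_mem_keep_iff hz _).1 hu) _ (D.lf_mem_keep.1 hv)
    · rw [φnd, φnd, CatData.anc_nd_nd, CatData.anc_nd_nd]
      exact hord _ ((D.nd_mem_keep_iff hz _).1 hu) _ ((D.nd_mem_keep_iff hz _).1 hv)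
  refine ⟨φ, ?_, fun x _ => rfl, fun u v hu hv => ?_⟩
  · rw [← himg]
    exact hinj.injOn.bijOn_image
  · have hu' : φ u ∈ D'.tree.keepSet B := himg ▸ ⟨u, hu, rfl⟩
    have hv' : φ v ∈ D'.tree.keepSet B := himg ▸ ⟨v, hv, rfl⟩
    rw [restAdj_iff, restAdj_iff, hanc u hu v hv, ← himg]
    constructor
    · rintro ⟨_, _, h1, h2, h3⟩
      refine ⟨⟨u, hu, rfl⟩, ⟨v, hv, rfl⟩, h1, fun h => h2 (hinj h), ?_⟩
      rintro _ ⟨w, hw, rfl⟩ h4 h5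
      rcases h3 w hw ((hanc u hu w hw).2 h4) ((hanc w hw v hv).2 h5) with rfl | rfl
      · exact Or.inl rfl
      · exact Or.inr rfl
    · rintro ⟨_, _, h1, h2, h3⟩
      refine ⟨hu, hv, h1, fun h => h2 (congrArg φ h), ?_⟩
      intro w hw h4 h5
      rcases h3 _ ⟨w, hw, rfl⟩ ((hanc u hu w hw).1 h4) ((hanc w hw v hv).1 h5) with h | h
      · exact Or.inl (hinj h)
      · exact Or.inr (hinj h)

/-- If a block holds `x, c, d` ordered `x < c < d` in one caterpillar and `c < d`, `c < x` in
another one, then the restrictions differ. -/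
lemma cat_not_restEq {X : Type} [Finite X] (D D' : CatData X) (B : Set X) {x c d : X}
    (hx : x ∈ B) (hc : c ∈ B) (hd : d ∈ B) (hcz : c ≠ D.z)
    (h1 : D.pos x < D.pos c) (h2 : D.pos c < D.pos d)
    (h3 : D'.pos c < D'.pos x) (h4 : D'.pos c < D'.pos d) : ¬ restEq D.tree D'.tree B := by
  rintro ⟨φ, hb, hl, hadj⟩
  have hp := D.nd_mem_keep hcz hc hd h2
  have hcd : c ≠ d := by rintro rfl; omega
  have e1 := (iso_anc hb hadj hp (D.tree.label_mem_keep hc)).1 ((D.anc_nd_lf _ _ _).2 le_rfl)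
  have e2 := (iso_anc hb hadj hp (D.tree.label_mem_keep hd)).1 ((D.anc_nd_lf _ _ _).2 h2.le)
  rw [hl c hc] at e1
  rw [hl d hd] at e2
  obtain ⟨a, ha, hpa, h5, _⟩ := D'.common_anc hcd e1 e2
  have e3 : D'.tree.anc (φ (D.nd c hcz)) (φ (D.tree.label x)) := by
    rw [hl x hx, hpa]
    exact (D'.anc_nd_lf _ _ _).2 (by omega)
  have e4 := (D.anc_nd_lf _ _ _).1 ((iso_anc hb hadj hp (D.tree.label_mem_keep hx)).2 e3)
  omega

/-- Taxa: `none` is the bottom taxon, `some (inl a)` the chain, `some (inr j)` the others. -/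
abbrev Tax (k : ℕ) : Type := Option (Fin (2 * k + 1) ⊕ Fin (k + 1))

/-- Position in the `i`-th tree: the chain is inserted before the `i`-th other taxon. -/
def tpos (k : ℕ) (i : Fin (k + 2)) : Tax k → ℕ
  | none => 4 * k + 10
  | some (Sum.inl a) => i + a
  | some (Sum.inr j) => if (j : ℕ) < i then j else j + (2 * k + 1)

/-- The `i`-th caterpillar. -/
def tdata (k : ℕ) (i : Fin (k + 2)) : CatData (Tax k) where
  z := none
  pos := tpos k i
  inj := by
    have hi := i.2
    rintro (_ | a | j) (_ | b | l) h <;> simp only [tpos] at h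
    · rfl
    · omega
    · split_ifs at h <;> omega
    · omega
    · congr 2; ext; omega
    · split_ifs at h <;> omega
    · split_ifs at h <;> omega
    · split_ifs at h <;> omega
    · congr 2; ext; split_ifs at h <;> omega
  le_z := by
    have hi := i.2
    rintro (_ | a | j) <;> simp only [tpos]
    · omega
    · omega
    · split_ifs <;> omega
  ne := ⟨some (Sum.inl 0), by simp⟩

lemma tdata_pos (k : ℕ) (i : Fin (k + 2)) : (tdata k i).pos = tpos k i := rfl

/-- Chain taxa. -/
def ch (k : ℕ) (a : Fin (2 * k + 1)) : Tax k := some (Sum.inl a)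
/-- Other taxa. -/
def yy (k : ℕ) (j : Fin (k + 1)) : Tax k := some (Sum.inr j)

lemma ch_pos (k : ℕ) (i a) : (tdata k i).pos (ch k a) = i + a := rfl
lemma yy_pos_lt (k : ℕ) (i : Fin (k + 2)) (j : Fin (k + 1)) (h : (j : ℕ) < i) :
    (tdata k i).pos (yy k j) = j := by simp [tdata, tpos, yy, h]
lemma yy_pos_ge (k : ℕ) (i : Fin (k + 2)) (j : Fin (k + 1)) (h : (i : ℕ) ≤ j) :
    (tdata k i).pos (yy k j) = j + (2 * k + 1) := by simp [tdata, tpos, yy, h]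
lemma ch_ne (k : ℕ) (i a) : ch k a ≠ (tdata k i).z := by simp [ch, tdata]
lemma yy_ne (k : ℕ) (i a) : yy k a ≠ (tdata k i).z := by simp [yy, tdata]

lemma tree_inj (k : ℕ) (hk : 4 ≤ k) : Function.Injective (fun i => (tdata k i).tree) := by
  have key : ∀ i j : Fin (k + 2), i < j → (tdata k i).tree ≠ (tdata k j).tree := by
    intro i j hij heq
    have hij' : (i : ℕ) < j := hij
    have hj := j.2
    let y := yy k ⟨i, by omega⟩
    let c0 := ch k ⟨0, by omega⟩
    let c1 := ch k ⟨1, by omega⟩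
    let P : RTree (Tax k) → Prop := fun T =>
      ∃ v, T.anc v (T.label c0) ∧ T.anc v (T.label c1) ∧ ¬ T.anc v (T.label y)
    have h1 : P (tdata k j).tree := by
      refine ⟨(tdata k j).nd c0 (ch_ne _ _ _), ?_, ?_, ?_⟩ <;>
        rw [CatData.label_eq, CatData.anc_nd_lf]
      · rw [ch_pos, ch_pos]; simp
      · rw [ch_pos, yy_pos_lt _ _ _ hij']; simp; omega
    have h2 : ¬ P (tdata k i).tree := by
      rintro ⟨v, hv0, hv1, hvy⟩
      obtain ⟨a, h, rfl, ha, _⟩ := (tdata k i).common_anc (by simp [c0, c1, ch]) hv0 hv1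
      apply hvy
      rw [CatData.label_eq, CatData.anc_nd_lf]
      rw [ch_pos] at ha
      rw [yy_pos_ge _ _ _ (le_refl _)]
      simp at ha ⊢
      omega
    exact h2 (heq ▸ h1)
  intro i j h
  rcases lt_trichotomy i j with h' | h' | h'
  · exact absurd h (key i j h')
  · exact h'
  · exact absurd h.symm (key j i h')

lemma tree_chain (k : ℕ) (i : Fin (k + 2)) : IsChainIn (tdata k i).tree (ch k) := by
  intro a ha p q hp hq
  have par : ∀ c (hc : c ≠ (tdata k i).z) p, (tdata k i).tree.E p ((tdata k i).tree.label c) →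
      p = (tdata k i).nd c hc := fun c hc p hp =>
    (tdata k i).tree.parent_unique hp (Or.inl rfl)
  rw [par _ (ch_ne _ _ _) p hp, par _ (ch_ne _ _ _) q hq]
  right
  refine ⟨?_, fun c hc => ?_⟩
  · change (tdata k i).pos _ < (tdata k i).pos _
    rw [ch_pos, ch_pos]; simp
  · change (tdata k i).pos _ ≤ (tdata k i).pos (ch k _) ∨
      (tdata k i).pos (ch k _) ≤ (tdata k i).pos _
    rw [ch_pos, ch_pos]
    simp only
    omega

lemma lower_bound (k : ℕ) (hk : 4 ≤ k) (F : Set (Set (Tax k)))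
    (hF : IsAgreementForest (Set.range fun i => (tdata k i).tree) F) : k + 1 ≤ F.ncard := by
  obtain ⟨⟨_, hpart⟩, heq, hdis⟩ := hF
  by_contra hlt
  choose bl hbl hun using hpart
  have hFfin : F.Finite := Set.toFinite F
  -- two chain taxa in one block
  obtain ⟨a, b, hab, hblk⟩ : ∃ a b : Fin (2 * k + 1), a < b ∧ bl (ch k a) = bl (ch k b) := by
    by_contra hcon
    push Not at hcon
    have hinj : Function.Injective (fun a => bl (ch k a)) := by
      intro a b h
      rcases lt_trichotomy a b with h' | h' | h'
      · exact absurd h (hcon a b h')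
      · exact h'
      · exact absurd h.symm (hcon b a h')
    have h1 : (Set.range (fun a => bl (ch k a))).ncard = 2 * k + 1 := by
      rw [← Set.image_univ, Set.ncard_image_of_injective _ hinj]; simp
    have h2 := Set.ncard_le_ncard
      (show Set.range (fun a => bl (ch k a)) ⊆ F by rintro _ ⟨a, rfl⟩; exact (hbl _).1) hFfin
    omega
  have hab' : (a : ℕ) < b := hab
  set B := bl (ch k a) with hB
  have hBF : B ∈ F := (hbl _).1
  have haB : ch k a ∈ B := (hbl _).2
  have hbB : ch k b ∈ B := hblk ▸ (hbl _).2
  have hcab : ch k a ≠ ch k b := by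
    intro h
    have : a = b := by simpa [ch] using h
    omega
  have key : ∀ j l : Fin (k + 1), j < l → bl (yy k j) ≠ bl (yy k l) := by
    intro j l hjl h
    have hjl' : (j : ℕ) < l := hjl
    have hl := l.2
    have hj : yy k j ∈ bl (yy k j) := (hbl _).2
    have hl' : yy k l ∈ bl (yy k j) := h ▸ (hbl _).2
    by_cases hBB : bl (yy k j) = B
    · rw [hBB] at hj
      refine cat_not_restEq (tdata k ⟨k + 1, by omega⟩) (tdata k ⟨0, by omega⟩) B hj haB hbB
        (ch_ne _ _ _) ?_ ?_ ?_ ?_ (heq B hBF _ ⟨_, rfl⟩ _ ⟨_, rfl⟩)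
      · rw [ch_pos, yy_pos_lt _ _ _ (by simp only; omega)]; simp only; omega
      · rw [ch_pos, ch_pos]; omega
      · rw [ch_pos, yy_pos_ge _ _ _ (by simp)]; simp only; omega
      · rw [ch_pos, ch_pos]; omega
    · have hd := hdis _ (hbl (yy k j)).1 B hBF hBB _ ⟨⟨l, by omega⟩, rfl⟩
      have m1 := (tdata k ⟨l, by omega⟩).nd_mem_span (ch_ne k _ a) hj hl'
        (by rw [ch_pos, yy_pos_lt _ _ _ (by simpa using hjl')]; simp only; omega)
        (by rw [ch_pos, yy_pos_ge _ _ _ (by simp)]; simp only; omega)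
        (by
          intro h
          have : j = l := by simpa [yy] using h
          omega)
      have m2 := (tdata k ⟨l, by omega⟩).nd_mem_span (ch_ne k _ a) haB hbB le_rfl
        (by rw [ch_pos, ch_pos]; omega) hcab
      exact Set.disjoint_left.1 hd m1 m2
  have hinj : Function.Injective (fun a => bl (yy k a)) := by
    intro a b h
    rcases lt_trichotomy a b with h' | h' | h'
    · exact absurd h (key a b h')
    · exact h'
    · exact absurd h.symm (key b a h')
  have h1 : (Set.range (fun a => bl (yy k a))).ncard = k + 1 := by
    rw [← Set.image_univ, Set.ncard_image_of_injective _ hinj]; simp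
  have h2 := Set.ncard_le_ncard
    (show Set.range (fun a => bl (yy k a)) ⊆ F by rintro _ ⟨a, rfl⟩; exact (hbl _).1) hFfin
  omega

/-- A forest made of one block and singletons. -/
lemma forest_of_block {S : Type} (𝒯 : Set (RTree S)) (R : Set S) (hR : R.Nonempty)
    (h : ∀ T ∈ 𝒯, ∀ T' ∈ 𝒯, restEq T T' R) :
    IsAgreementForest 𝒯 (insert R ((fun x => ({x} : Set S)) '' Rᶜ)) := by
  refine ⟨⟨?_, ?_⟩, ?_, ?_⟩
  · rintro B (rfl | ⟨x, _, rfl⟩)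
    · exact hR
    · exact ⟨x, rfl⟩
  · intro x
    by_cases hx : x ∈ R
    · refine ⟨R, ⟨Or.inl rfl, hx⟩, ?_⟩
      rintro B ⟨rfl | ⟨y, hy, rfl⟩, hxB⟩
      · rfl
      · have : x = y := hxB
        subst this
        exact absurd hx hy
    · refine ⟨{x}, ⟨Or.inr ⟨x, hx, rfl⟩, rfl⟩, ?_⟩
      rintro B ⟨rfl | ⟨y, hy, rfl⟩, hxB⟩
      · exact absurd hxB hx
      · have : x = y := hxB
        rw [this]
  · rintro B (rfl | ⟨x, _, rfl⟩) T hT T' hT'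
    · exact h T hT T' hT'
    · exact restEq_singleton T T' x
  · rintro B (rfl | ⟨x, hx, rfl⟩) B' (rfl | ⟨y, hy, rfl⟩) hne T hT
    · exact absurd rfl hne
    · rw [span_singleton, Set.disjoint_singleton_right, label_mem_span]
      exact hy
    · rw [span_singleton, Set.disjoint_singleton_left, label_mem_span]
      exact hx
    · rw [span_singleton, span_singleton, Set.disjoint_singleton]
      intro h'
      exact hne (by rw [T.label_inj h'])

end RTree

open RTree

/-- **Tightness of the truncation length in `k` (rooted).** For every `k ≥ 4` there
exist a finite taxon set `X`, a set `𝒯` of `t = k+2` rooted binary phylogenetic trees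
on `X`, and a common `m`-chain `x` of `𝒯` with `m = 2k+1`, such that every rooted
agreement forest for `𝒯` has size at least `k+1`, while the trees obtained by truncating
the chain to length `k−1` (restricting to `X ∖ {x_k, …, x_m}`) have a rooted agreement
forest of size at most `k`. -/
theorem truncation_to_k_minus_one_not_safe_rooted (k : ℕ) (hk : 4 ≤ k) :
    ∃ (X : Type) (_ : Finite X) (𝒯 : Set (RTree X)) (x : Fin (2 * k + 1) → X),
      𝒯.ncard = k + 2 ∧ RTree.IsCommonChain 𝒯 x ∧
      (∀ F, RTree.IsAgreementForest 𝒯 F → k + 1 ≤ F.ncard) ∧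
      ∀ XC : Set X, XC = {a : X | ¬ ∃ i : Fin (2 * k + 1), k - 1 ≤ (i : ℕ) ∧ x i = a} →
        ∃ 𝒯C : Set (RTree ↥XC), RTree.IsRestrictionFamily 𝒯 XC 𝒯C ∧
          ∃ F, RTree.IsAgreementForest 𝒯C F ∧ F.ncard ≤ k := by
  have hfin : Finite (Tax k) := inferInstance
  refine ⟨Tax k, hfin, Set.range fun i => (tdata k i).tree, ch k, ?_, ?_, lower_bound k hk, ?_⟩
  · rw [← Set.image_univ, Set.ncard_image_of_injective _ (tree_inj k hk)]; simp
  · refine ⟨by omega, fun a b h => by simpa [ch] using h, ?_⟩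
    rintro _ ⟨i, rfl⟩
    exact tree_chain k i
  · intro XC hXC
    have hz : ∀ i, (tdata k i).z ∈ XC := by
      intro i
      rw [hXC]
      rintro ⟨a, _, ha⟩
      exact ch_ne k i a ha
    have hne : ∀ i, ∃ a ∈ XC, a ≠ (tdata k i).z := by
      intro i
      refine ⟨yy k 0, ?_, yy_ne k i 0⟩
      rw [hXC]
      rintro ⟨a, _, ha⟩
      simp [ch, yy] at ha
    refine ⟨Set.range fun i => ((tdata k i).restrict XC (hz i) (hne i)).tree, ⟨?_, ?_⟩, ?_⟩
    · rintro _ ⟨i, rfl⟩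
      exact ⟨_, ⟨i, rfl⟩, (tdata k i).isRestriction XC (hz i) (hne i)⟩
    · rintro _ ⟨i, rfl⟩
      exact ⟨_, ⟨i, rfl⟩, (tdata k i).isRestriction XC (hz i) (hne i)⟩
    · let R : Set XC := {x | ∀ a, ch k a ≠ x.1}
      have hzR : ∀ i, (⟨(tdata k i).z, hz i⟩ : XC) ∈ R := fun i a => ch_ne k i a
      refine ⟨_, forest_of_block _ R ⟨_, hzR 0⟩ ?_, ?_⟩
      · rintro _ ⟨i, rfl⟩ _ ⟨j, rfl⟩
        refine cat_restEq ((tdata k i).restrict XC (hz i) (hne i))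
          ((tdata k j).restrict XC (hz j) (hne j)) rfl R (hzR i) ?_
        rintro ⟨x, hxX⟩ hx ⟨y, hyX⟩ hy
        change (tdata k i).pos x ≤ (tdata k i).pos y ↔ (tdata k j).pos x ≤ (tdata k j).pos y
        have hi := i.2
        have hj := j.2
        rw [tdata_pos, tdata_pos]
        rcases x with _ | a | l
        · rcases y with _ | b | m
          · simp
          · exact absurd rfl (hy b)
          · simp only [tpos]
            split_ifs <;> omega
        · exact absurd rfl (hx a)
        · rcases y with _ | b | m
          · simp only [tpos]
            split_ifs <;> omega
          · exact absurd rfl (hy b)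
          · simp only [tpos]
            split_ifs <;> omega
      · have hsub : Subtype.val '' Rᶜ ⊆ ch k '' {a | (a : ℕ) < k - 1} := by
          rintro _ ⟨⟨x, hxX⟩, hx, rfl⟩
          simp only [R, Set.mem_compl_iff, Set.mem_ofPred_eq, not_forall, not_not] at hx
          obtain ⟨a, ha⟩ := hx
          refine ⟨a, ?_, ha⟩
          rw [hXC] at hxX
          by_contra hcon
          exact hxX ⟨a, not_lt.1 hcon, ha⟩
        have h1 := Set.ncard_le_ncard hsub (Set.toFinite _)
        rw [Set.ncard_image_of_injective _ Subtype.val_injective] at h1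
        have h2 : (ch k '' {a | (a : ℕ) < k - 1}).ncard ≤ k - 1 := by
          refine (Set.ncard_image_le (Set.toFinite _)).trans ?_
          rw [← Set.ncard_image_of_injective _ Fin.val_injective]
          refine (Set.ncard_le_ncard (t := Set.Iio (k - 1)) ?_ (Set.finite_Iio _)).trans ?_
          · rintro _ ⟨a, ha, rfl⟩
            exact ha
          · rw [Set.ncard_eq_toFinset_card']; simp
        have h3 := Set.ncard_image_le (f := fun x => ({x} : Set XC)) (Set.toFinite Rᶜ)
        have h4 := Set.ncard_insert_le R ((fun x => ({x} : Set XC)) '' Rᶜ)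
        omega
end
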